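/- arXiv:2102.12830 — 2 statements merged into one kernel-verified Lean document; each statement's English description precedes it below -/
import Mathlib

section
/- For every integer ℓ ≥ 4 with ℓ ≡ 3 (mod 12), there exists n₀ = n₀(ℓ) such that every oriented graph G on n ≥ n₀ vertices with minimum semidegree δ±(G) ≥ n/4 + 1/4 contains a directed cycle of length exactly ℓ. -/
/-- The outdegree of a vertex `v` in the directed graph with edge relation `E`. -/
noncomputable def outDeg {n : ℕ} (E : Fin n → Fin n → Prop) (v : Fin n) : ℕ :=
  {w | E v w}.ncard

/-- The indegree of a vertex `v` in the directed graph with edge relation `E`. -/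
noncomputable def inDeg {n : ℕ} (E : Fin n → Fin n → Prop) (v : Fin n) : ℕ :=
  {w | E w v}.ncard

/-- The semidegree of a vertex: the minimum of its outdegree and indegree. -/
noncomputable def semiDeg {n : ℕ} (E : Fin n → Fin n → Prop) (v : Fin n) : ℕ :=
  min (outDeg E v) (inDeg E v)

/-- `E` is an oriented graph: no loops and no pair of opposite edges. -/
def Oriented {n : ℕ} (E : Fin n → Fin n → Prop) : Prop :=
  (∀ v, ¬ E v v) ∧ (∀ u v, E u v → ¬ E v u)

/-- The graph contains a directed cycle of length exactly `t`:
`t` distinct vertices cyclically joined by edges. -/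
def HasDiCycle {n : ℕ} (E : Fin n → Fin n → Prop) (t : ℕ) : Prop :=
  ∃ v : ZMod t → Fin n, Function.Injective v ∧ ∀ i, E (v i) (v (i + 1))

/-- The graph contains a closed directed walk of length `t` (vertices may repeat). -/
def HasClosedWalk {n : ℕ} (E : Fin n → Fin n → Prop) (t : ℕ) : Prop :=
  ∃ w : ℕ → Fin n, w 0 = w t ∧ ∀ i < t, E (w i) (w (i + 1))

/-- There is a directed path of length `t` from `x` to `y` (all vertices distinct). -/
def HasPath {n : ℕ} (E : Fin n → Fin n → Prop) (x y : Fin n) (t : ℕ) : Prop :=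
  ∃ u : Fin (t + 1) → Fin n, Function.Injective u ∧ u 0 = x ∧ u (Fin.last t) = y ∧
    ∀ i : Fin t, E (u i.castSucc) (u i.succ)

/-- The graph contains an `s`-shortcut: a directed path `v₀ v₁ ⋯ v_s` on distinct
vertices together with the additional edge `v₀ v_s`. -/
def HasShortcut {n : ℕ} (E : Fin n → Fin n → Prop) (s : ℕ) : Prop :=
  ∃ v : Fin (s + 1) → Fin n, Function.Injective v ∧
    (∀ i : Fin s, E (v i.castSucc) (v i.succ)) ∧ E (v 0) (v (Fin.last s))

/-- The graph is homomorphic to the directed cycle `C_k`. -/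
def HomToCycle {n : ℕ} (E : Fin n → Fin n → Prop) (k : ℕ) : Prop :=
  ∃ f : Fin n → ZMod k, ∀ u v, E u v → f v = f u + 1

namespace DiCycle

open Finset
open scoped Classical

section Walks

variable {V : Type*}

/-- `Walk R k u v` says that there is a directed walk with `k` edges from `u` to `v`. -/
def Walk (R : V → V → Prop) : ℕ → V → V → Prop
  | 0, u, v => u = v
  | k + 1, u, v => ∃ w, R u w ∧ Walk R k w v

variable {R : V → V → Prop}

theorem Walk.cons {k : ℕ} {u v w : V} (h : R u v) (h' : Walk R k v w) : Walk R (k + 1) u w :=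
  ⟨v, h, h'⟩

theorem Walk.single {u v : V} (h : R u v) : Walk R 1 u v := ⟨v, h, rfl⟩

theorem Walk.append {a b : ℕ} {u v w : V} (h : Walk R a u v) (h' : Walk R b v w) :
    Walk R (a + b) u w := by
  induction a generalizing u with
  | zero => cases h; simpa using h'
  | succ k ih =>
    obtain ⟨x, hx, hk⟩ := h
    rw [Nat.add_right_comm]
    exact ⟨x, hx, ih hk⟩

theorem Walk.repeat {a : ℕ} {u : V} (h : Walk R a u u) (k : ℕ) : Walk R (a * k) u u := by
  induction k with
  | zero => rfl
  | succ k ih => rw [Nat.mul_succ]; exact ih.append h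

theorem Walk.flip {k : ℕ} {u v : V} (h : Walk (fun a b => R b a) k u v) : Walk R k v u := by
  induction k generalizing u with
  | zero => exact h.symm
  | succ k ih =>
    obtain ⟨w, hw, hk⟩ := h
    exact (ih hk).append (Walk.single hw)

theorem Walk.exists_fun {k : ℕ} {u v : V} (h : Walk R k u v) :
    ∃ f : ℕ → V, f 0 = u ∧ f k = v ∧ ∀ i < k, R (f i) (f (i + 1)) := by
  induction k generalizing u with
  | zero => exact ⟨fun _ => u, rfl, h, by simp⟩
  | succ k ih =>
    obtain ⟨w, hw, hk⟩ := h
    obtain ⟨f, h0, h1, h2⟩ := ih hk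
    refine ⟨fun i => Nat.casesOn i u f, rfl, h1, ?_⟩
    rintro (_ | i) hi
    · simpa [h0] using hw
    · exact h2 i (by omega)

theorem Walk.of_fun {f : ℕ → V} (hf : ∀ i, R (f i) (f (i + 1))) (i k : ℕ) :
    Walk R k (f i) (f (i + k)) := by
  induction k generalizing i with
  | zero => rfl
  | succ k ih => exact ⟨_, hf i, by simpa [Nat.add_comm, Nat.add_left_comm] using ih (i + 1)⟩

end Walks

section Neighbourhoods

variable {V : Type*} [Fintype V]

/-- The set of outneighbours of `v`. -/
noncomputable def outN (R : V → V → Prop) (v : V) : Finset V := univ.filter fun w => R v w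

/-- The set of inneighbours of `v`. -/
noncomputable def inN (R : V → V → Prop) (v : V) : Finset V := univ.filter fun w => R w v

variable {R : V → V → Prop}

@[simp] theorem mem_outN {v w : V} : w ∈ outN R v ↔ R v w := by simp [outN]

@[simp] theorem mem_inN {v w : V} : w ∈ inN R v ↔ R w v := by simp [inN]

theorem sum_card_outN_inter (S T : Finset V) :
    ∑ v ∈ S, #(outN R v ∩ T) = ∑ v ∈ T, #(inN R v ∩ S) := by
  have := sum_card_bipartiteAbove_eq_sum_card_bipartiteBelow (s := S) (t := T) R
  simp only [bipartiteAbove, bipartiteBelow] at this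
  convert this using 3 with v _ v _ <;> ext w <;> simp [and_comm]

theorem exists_two_mul_card_outN_inter_le (hR : ∀ u v, R u v → ¬ R v u) {S : Finset V}
    (hS : S.Nonempty) : ∃ v ∈ S, 2 * #(outN R v ∩ S) ≤ #S := by
  have h1 : ∑ v ∈ S, 2 * #(outN R v ∩ S) ≤ ∑ _v ∈ S, #S := by
    calc ∑ v ∈ S, 2 * #(outN R v ∩ S)
        = ∑ v ∈ S, (#(outN R v ∩ S) + #(inN R v ∩ S)) := by
          rw [sum_add_distrib, ← sum_card_outN_inter, ← mul_sum, two_mul]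
      _ ≤ ∑ _v ∈ S, #S := by
          refine sum_le_sum fun v _ => ?_
          rw [← card_union_of_disjoint]
          · exact card_le_card (union_subset inter_subset_right inter_subset_right)
          · rw [disjoint_left]
            intro w hw hw'
            simp only [mem_inter, mem_outN, mem_inN] at hw hw'
            exact hR _ _ hw.1 hw'.1
  exact exists_le_of_sum_le hS h1

/-- A set of vertices in a triangle-free oriented graph contains a vertex of outdegree at most
`2/5` of its size inside the set. -/
theorem exists_five_mul_card_outN_inter_le (hR : ∀ u v, R u v → ¬ R v u)
    (h3 : ∀ a b c, R a b → R b c → ¬ R c a) {S : Finset V} (hS : S.Nonempty) :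
    ∃ v ∈ S, 5 * #(outN R v ∩ S) ≤ 2 * #S := by
  by_contra! hcon
  obtain ⟨u, hu, hmin⟩ := exists_min_image S (fun v => #(outN R v ∩ S)) hS
  have hd := hcon u hu
  set d := #(outN R u ∩ S)
  obtain ⟨v, hv, hvd⟩ : ∃ v ∈ S, d ≤ #(inN R v ∩ S) := by
    refine exists_le_of_sum_le hS ?_
    rw [← sum_card_outN_inter]
    exact sum_le_sum hmin
  have hA : (outN R v ∩ S).Nonempty := by
    rw [← card_pos]; have := hcon v hv; omega
  obtain ⟨w, hw, hw2⟩ := exists_two_mul_card_outN_inter_le hR hA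
  set A := outN R v ∩ S with hAdef
  have hwS : w ∈ S := (mem_inter.1 hw).2
  have hvw : R v w := mem_outN.1 (mem_inter.1 hw).1
  have e1 : #(outN R w ∩ S) ≤ #(outN R w ∩ A) + #((outN R w ∩ S) \ A) := by
    rw [← card_inter_add_card_sdiff (outN R w ∩ S) A]
    gcongr
    exact inter_subset_left
  have e2 : #A + #(inN R v ∩ S) + #((outN R w ∩ S) \ A) ≤ #S := by
    rw [← card_union_of_disjoint, ← card_union_of_disjoint]
    · refine card_le_card (union_subset (union_subset inter_subset_right inter_subset_right) ?_)
      exact sdiff_subset.trans inter_subset_right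
    · rw [disjoint_left]
      intro x hx hx'
      simp only [mem_union, mem_sdiff, mem_inter, mem_outN, mem_inN, hAdef] at hx hx'
      rcases hx with hx | hx
      · exact hx'.2 hx
      · exact h3 _ _ _ hvw hx'.1.1 hx.1
    · rw [disjoint_left]
      intro x hx hx'
      simp only [mem_inter, mem_outN, mem_inN, hAdef] at hx hx'
      exact hR _ _ hx.1 hx'.1
  have e3 : d ≤ #(outN R w ∩ S) := hmin w hwS
  have e4 : d ≤ #A := hmin v hv
  omega

/-- The vertices that can be reached from `a` by a walk with between `1` and `k + 1` edges. -/
noncomputable def reach (R : V → V → Prop) (a : V) : ℕ → Finset V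
  | 0 => outN R a
  | k + 1 => reach R a k ∪ univ.filter fun v => ∃ u ∈ reach R a k, R u v

theorem walk_of_mem_reach {a v : V} {k : ℕ} (h : v ∈ reach R a k) :
    ∃ j, 1 ≤ j ∧ j ≤ k + 1 ∧ Walk R j a v := by
  induction k generalizing v with
  | zero => exact ⟨1, le_rfl, le_rfl, Walk.single (mem_outN.1 h)⟩
  | succ k ih =>
    simp only [reach, mem_union, mem_filter, mem_univ, true_and] at h
    rcases h with h | ⟨u, hu, huv⟩
    · obtain ⟨j, h1, h2, h3⟩ := ih h
      exact ⟨j, h1, by omega, h3⟩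
    · obtain ⟨j, h1, h2, h3⟩ := ih hu
      exact ⟨j + 1, by omega, by omega, h3.append (Walk.single huv)⟩

theorem card_reach_three (hR : ∀ u v, R u v → ¬ R v u)
    (h3 : ∀ a b c, R a b → R b c → ¬ R c a) {δ : ℕ} (hδ : 0 < δ) (hout : ∀ v, δ ≤ #(outN R v))
    (a : V) : 272 * δ ≤ 125 * #(reach R a 3) := by
  have step : ∀ k, δ ≤ #(reach R a k) → 3 * #(reach R a k) + 5 * δ ≤ 5 * #(reach R a (k + 1)) := by
    intro k hk
    have hne : (reach R a k).Nonempty := by rw [← card_pos]; omega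
    obtain ⟨v, hv, hv5⟩ := exists_five_mul_card_outN_inter_le hR h3 hne
    have e1 : #(reach R a k) + #(outN R v \ reach R a k) ≤ #(reach R a (k + 1)) := by
      rw [← card_union_of_disjoint disjoint_sdiff]
      refine card_le_card fun w hw => ?_
      simp only [reach, mem_union, mem_filter, mem_univ, true_and]
      rcases mem_union.1 hw with hw | hw
      · exact Or.inl hw
      · exact Or.inr ⟨v, hv, mem_outN.1 (mem_sdiff.1 hw).1⟩
    have e2 := card_inter_add_card_sdiff (outN R v) (reach R a k)
    have e3 := hout v
    omega
  have s0 : δ ≤ #(reach R a 0) := hout a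
  have s1 : _ ≤ 5 * #(reach R a 1) := step 0 s0
  have s2 : _ ≤ 5 * #(reach R a 2) := step 1 (by omega)
  have s3 : _ ≤ 5 * #(reach R a 3) := step 2 (by omega)
  omega

theorem exists_walk_le_eight (hR : ∀ u v, R u v → ¬ R v u)
    (h3 : ∀ a b c, R a b → R b c → ¬ R c a) {δ : ℕ} (hout : ∀ v, δ ≤ #(outN R v))
    (hin : ∀ v, δ ≤ #(inN R v)) (hN : 17 * Fintype.card V < 69 * δ) (a x : V) :
    ∃ d, 1 ≤ d ∧ d ≤ 8 ∧ Walk R d a x := by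
  have f1 := card_reach_three hR h3 (by omega) hout a
  have f2 := card_reach_three (R := fun a b => R b a) (fun u v h h' => hR _ _ h h')
    (fun a b c h h' h'' => h3 _ _ _ h' h h'') (by omega) (δ := δ) hin x
  have : ¬ Disjoint (reach R a 3) (reach (fun a b => R b a) x 3) := by
    intro hd
    have := card_le_univ (reach R a 3 ∪ reach (fun a b => R b a) x 3)
    rw [card_union_of_disjoint hd] at this
    omega
  rw [not_disjoint_iff] at this
  obtain ⟨v, hv, hv'⟩ := this
  obtain ⟨j, j1, j2, hj⟩ := walk_of_mem_reach hv
  obtain ⟨i, i1, i2, hi⟩ := walk_of_mem_reach hv'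
  exact ⟨j + i, by omega, by omega, hj.append hi.flip⟩

/-- If short walks join all pairs of vertices and there is no closed walk with `ℓ` edges, then
no nonempty set of outneighbours of a vertex spans positive outdegree. -/
theorem exists_sink {ℓ : ℕ} (hℓ : 9 ≤ ℓ) (hno : ∀ x, ¬ Walk R ℓ x x)
    (hdiam : ∀ a x, ∃ d, 1 ≤ d ∧ d ≤ 8 ∧ Walk R d a x) {x : V} {D : Finset V} (hD : D.Nonempty)
    (hDx : ∀ v ∈ D, R x v) : ∃ y ∈ D, ∀ w ∈ D, ¬ R y w := by
  by_contra! hcon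
  choose! g hgD hg using hcon
  obtain ⟨v, hv⟩ := hD
  let f : ℕ → V := fun i => g^[i] v
  have hfD : ∀ i, f i ∈ D := by
    intro i
    induction i with
    | zero => exact hv
    | succ i ih => simp only [f, Function.iterate_succ_apply']; exact hgD _ ih
  have hf : ∀ i, R (f i) (f (i + 1)) := by
    intro i
    simp only [f, Function.iterate_succ_apply']
    exact hg _ (hfD i)
  obtain ⟨d, d1, d2, hd⟩ := hdiam (f ℓ) x
  have w₁ := Walk.of_fun hf (d + 1) (ℓ - d - 1)
  rw [show d + 1 + (ℓ - d - 1) = ℓ by omega] at w₁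
  have w₂ := (Walk.cons (hDx _ (hfD (d + 1))) w₁).append hd
  rw [show ℓ - d - 1 + 1 + d = ℓ by omega] at w₂
  exact hno x w₂

/-- An oriented graph with large minimum semidegree that contains three pairwise adjacent
vertices has a closed walk with `ℓ` edges. -/
theorem exists_closed_walk (hR : ∀ u v, R u v → ¬ R v u) {δ : ℕ}
    (hout : ∀ v, δ ≤ #(outN R v)) (hin : ∀ v, δ ≤ #(inN R v))
    (hN : 17 * Fintype.card V < 69 * δ) {ℓ : ℕ} (hℓ : 4 ≤ ℓ) (hmod : ℓ % 12 = 3) {x z y₀ : V}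
    (hxz : R x z) (hzy : R z y₀) (hxy : R x y₀ ∨ R y₀ x) : ∃ v, Walk R ℓ v v := by
  by_contra! hno
  obtain ⟨m, rfl⟩ : ∃ m, ℓ = 12 * m + 15 := ⟨ℓ / 12 - 1, by omega⟩
  have h3 : ∀ a b c, R a b → R b c → ¬ R c a := by
    intro a b c hab hbc hca
    have w : Walk R 3 a a := ⟨b, hab, c, hbc, a, hca, rfl⟩
    have w' := w.repeat (4 * m + 5)
    rw [show 3 * (4 * m + 5) = 12 * m + 15 by ring] at w'
    exact hno a w'
  have h45 : ∀ a, Walk R 4 a a → ¬ Walk R 5 a a := by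
    intro a w w'
    have := (w.repeat (3 * m)).append (w'.repeat 3)
    rw [show 4 * (3 * m) + 5 * 3 = 12 * m + 15 by ring] at this
    exact hno a this
  have h56 : ∀ a, Walk R 5 a a → ¬ Walk R 6 a a := by
    intro a w w'
    have := (w'.repeat (2 * m)).append (w.repeat 3)
    rw [show 6 * (2 * m) + 5 * 3 = 12 * m + 15 by ring] at this
    exact hno a this
  have h47 : ∀ a, Walk R 4 a a → ¬ Walk R 7 a a := by
    intro a w w'
    have := (w.repeat (3 * m + 2)).append w'
    rw [show 4 * (3 * m + 2) + 7 = 12 * m + 15 by ring] at this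
    exact hno a this
  have hdiam := exists_walk_le_eight hR h3 hout hin hN
  have hdiam' : ∀ a x, ∃ d, 1 ≤ d ∧ d ≤ 8 ∧ Walk (fun a b => R b a) d a x := fun a x => by
    obtain ⟨d, d1, d2, hd⟩ := hdiam x a
    exact ⟨d, d1, d2, Walk.flip (R := fun a b => R b a) hd⟩
  have hxy : R x y₀ := hxy.resolve_right (h3 _ _ _ hxz hzy)
  obtain ⟨y, hy, hysink⟩ := exists_sink (by omega) hno hdiam (x := x)
    (D := univ.filter fun v => R x v ∧ ∃ z, R x z ∧ R z v) ⟨y₀, by simp; exact ⟨hxy, z, hxz, hzy⟩⟩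
    (by simp; tauto)
  simp only [mem_filter, mem_univ, true_and] at hy hysink
  obtain ⟨hxy, z, hxz, hzy⟩ := hy
  obtain ⟨p, hyp, hp⟩ := exists_sink (by omega) hno hdiam (x := y) (D := outN R y)
    (by rw [← card_pos]; have := hout y; omega) (by simp)
  obtain ⟨q, hqx, hq⟩ := exists_sink (R := fun a b => R b a) (ℓ := 12 * m + 15) (by omega)
    (fun v w => hno v w.flip) hdiam' (x := x) (D := inN R x)
    (by rw [← card_pos]; have := hin x; omega) (by simp)
  simp only [mem_outN, mem_inN] at hyp hp hqx hq
  -- walks from `y` to `x` with two, three or four edges do not exist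
  have n2 : ∀ a, R y a → ¬ R a x := fun a h h' => h3 _ _ _ hxy h h'
  have n3 : ∀ a b, R y a → R a b → ¬ R b x := fun a b h h' h'' =>
    h45 x ⟨y, hxy, a, h, b, h', x, h'', rfl⟩ ⟨z, hxz, y, hzy, a, h, b, h', x, h'', rfl⟩
  have n4 : ∀ a b c, R y a → R a b → R b c → ¬ R c x := fun a b c h h' h'' h''' =>
    h56 x ⟨y, hxy, a, h, b, h', c, h'', x, h''', rfl⟩
      ⟨z, hxz, y, hzy, a, h, b, h', c, h'', x, h''', rfl⟩
  set P := outN R y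
  set S := outN R p
  set Q := inN R x
  set S' := inN R q
  set S₁ := S ∩ outN R x
  set U := univ \ (P ∪ S ∪ Q ∪ S')
  have dPS : Disjoint P S := disjoint_left.2 fun a h h' => hp a (mem_outN.1 h) (mem_outN.1 h')
  have dQS : Disjoint Q S' := disjoint_left.2 fun a h h' => hq a (mem_inN.1 h) (mem_inN.1 h')
  have dPSQ : Disjoint (P ∪ S) Q := by
    rw [disjoint_left]
    intro a h h'
    simp only [P, S, Q, mem_union, mem_outN, mem_inN] at h h'
    rcases h with h | h
    · exact n2 _ h h'
    · exact n3 _ _ hyp h h'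
  have dall : Disjoint (P ∪ S ∪ Q) S' := by
    rw [disjoint_union_left]
    refine ⟨?_, dQS⟩
    rw [disjoint_left]
    intro a h h'
    simp only [P, S, S', mem_union, mem_outN, mem_inN] at h h'
    rcases h with h | h
    · exact n3 _ _ h h' hqx
    · exact n4 _ _ _ hyp h h' hqx
  have cU : #P + #S + #Q + #S' + #U = Fintype.card V := by
    rw [← card_union_of_disjoint dPS, ← card_union_of_disjoint dPSQ, ← card_union_of_disjoint dall,
      add_comm, card_sdiff_add_card_eq_card (subset_univ _), card_univ]
  have cP : δ ≤ #P := hout y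
  have cS : δ ≤ #S := hout p
  have cQ : δ ≤ #Q := hin x
  have cS' : δ ≤ #S' := hin q
  have cS₁ : δ ≤ #S₁ + #U := by
    refine (hout x).trans ((card_le_card ?_).trans (card_union_le _ _))
    intro a ha
    have hxa := mem_outN.1 ha
    by_cases haS : a ∈ S
    · exact mem_union_left _ (mem_inter.2 ⟨haS, ha⟩)
    · refine mem_union_right _ ?_
      simp only [U, mem_sdiff, mem_univ, true_and, mem_union, haS, or_false, P, Q, S', mem_outN,
        mem_inN, not_or]
      exact ⟨⟨fun h => hysink a ⟨hxa, y, hxy, h⟩ h, fun h => hR _ _ h hxa⟩,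
        fun h => h3 _ _ _ hxa h hqx⟩
  have cSS₁ : #(S \ S₁) + #S₁ = #S := card_sdiff_add_card_eq_card inter_subset_left
  have hW : (Q ∪ S').Nonempty := by rw [← card_pos, card_union_of_disjoint dQS]; omega
  obtain ⟨w, hw, hw5⟩ := exists_five_mul_card_outN_inter_le (R := fun a b => R b a)
    (fun u v h h' => hR _ _ h h') (fun a b c h h' h'' => h3 _ _ _ h' h h'') hW
  have hww : outN (fun a b => R b a) w = inN R w := rfl
  rw [hww, card_union_of_disjoint dQS] at hw5
  have cw : δ ≤ #(inN R w ∩ (Q ∪ S')) + (#(S \ S₁) + #U) := by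
    refine (hin w).trans ((card_le_card ?_).trans
      ((card_union_le _ _).trans (Nat.add_le_add_left (card_union_le _ _) _)))
    intro a ha
    have haw := mem_inN.1 ha
    simp only [mem_union, mem_inter, ha, true_and]
    by_cases haU : a ∈ U
    · tauto
    have haU' : a ∈ P ∨ a ∈ S ∨ a ∈ Q ∨ a ∈ S' := by
      simp only [U, mem_sdiff, mem_univ, true_and, not_not, mem_union] at haU; tauto
    rcases haU' with h | h | h | h
    · exfalso
      have h := mem_outN.1 h
      rcases mem_union.1 hw with hw | hw
      · exact n3 _ _ h haw (mem_inN.1 hw)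
      · exact n4 _ _ _ h haw (mem_inN.1 hw) hqx
    · refine Or.inr (Or.inl ?_)
      rw [mem_sdiff]
      refine ⟨h, fun h1 => ?_⟩
      have h := mem_outN.1 h
      have hxa := mem_outN.1 (mem_inter.1 h1).2
      rcases mem_union.1 hw with hw | hw
      · exact n4 _ _ _ hyp h haw (mem_inN.1 hw)
      · have hw := mem_inN.1 hw
        exact h47 x ⟨a, hxa, w, haw, q, hw, x, hqx, rfl⟩
          ⟨z, hxz, y, hzy, p, hyp, a, h, w, haw, q, hw, x, hqx, rfl⟩
    · tauto
    · tauto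
  omega

end Neighbourhoods

section Supersaturation

theorem card_injective_avoiding {V : Type} [Fintype V] (t : ℕ) (F : Finset V) :
    (Fintype.card V + 1 - #F - t) ^ t ≤
      #(univ.filter fun v : Fin t → V => Function.Injective v ∧ ∀ i, v i ∉ F) := by
  have h1 : Fintype.card (Fin t ↪ {a // a ∉ F}) = (Fintype.card V - #F).descFactorial t := by
    rw [Fintype.card_embedding_eq, Fintype.card_fin, Fintype.card_subtype_compl, Fintype.card_coe]
  calc (Fintype.card V + 1 - #F - t) ^ t ≤ (Fintype.card V - #F + 1 - t) ^ t :=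
        Nat.pow_le_pow_left (by omega) _
    _ ≤ Fintype.card (Fin t ↪ {a // a ∉ F}) := h1 ▸ Nat.pow_sub_le_descFactorial _ _
    _ = #(univ : Finset (Fin t ↪ {a // a ∉ F})) := card_univ.symm
    _ ≤ _ := by
        refine card_le_card_of_injOn (fun e i => (e i : V)) (fun e _ => ?_) (fun e _ e' _ h => ?_)
        · simp only [coe_filter, mem_univ, true_and, Set.mem_ofPred_eq]
          exact ⟨Subtype.val_injective.comp e.injective, fun i => (e i).2⟩
        · ext i
          exact congrFun h i

/-- A positive proportion of the pairs `(v, x)` with `v` a `t`-tuple extends all entries of `v`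
by `x` to an element of `S`. -/
theorem le_sum_card_common {V : Type} [Fintype V] [Nonempty V] (t s : ℕ) {c : ℝ} (hc : 0 ≤ c)
    (S : Finset (Fin (s + 1) → V)) (hS : c * (Fintype.card V : ℝ) ^ (s + 1) ≤ #S) :
    c ^ (t + 1) * (Fintype.card V : ℝ) ^ (s + (t + 1)) ≤
      ∑ v : Fin (t + 1) → V,
        (#(univ.filter fun x : Fin s → V =>
          ∀ j, (Fin.cons (v j) x : Fin (s + 1) → V) ∈ S) : ℝ) := by
  set n : ℝ := (Fintype.card V : ℝ)
  have hn : 0 < n := by simpa [n] using Fintype.card_pos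
  let D : (Fin s → V) → Finset V := fun x =>
    univ.filter fun a => (Fin.cons a x : Fin (s + 1) → V) ∈ S
  have h1 : ∑ v : Fin (t + 1) → V,
      (#(univ.filter fun x : Fin s → V => ∀ j, (Fin.cons (v j) x : Fin (s + 1) → V) ∈ S) : ℝ) =
      ∑ x : Fin s → V, (#(D x) : ℝ) ^ (t + 1) := by
    have := sum_card_bipartiteAbove_eq_sum_card_bipartiteBelow
      (s := (univ : Finset (Fin (t + 1) → V))) (t := (univ : Finset (Fin s → V)))
      (fun v x => ∀ j, (Fin.cons (v j) x : Fin (s + 1) → V) ∈ S)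
    simp only [bipartiteAbove, bipartiteBelow] at this
    rw [← Nat.cast_sum, this, Nat.cast_sum]
    refine sum_congr rfl fun x _ => ?_
    have h2 : (univ.filter fun v : Fin (t + 1) → V =>
        ∀ j, (Fin.cons (v j) x : Fin (s + 1) → V) ∈ S) = Fintype.piFinset fun _ => D x := by
      ext v; simp [D]
    rw [h2, Fintype.card_piFinset_const]
    push_cast
    rfl
  have h2 : (#S : ℝ) ≤ ∑ x : Fin s → V, (#(D x) : ℝ) := by
    rw [card_eq_sum_card_fiberwise (f := Fin.tail) (t := univ) (by intro; simp)]
    push_cast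
    refine sum_le_sum fun x _ => Nat.cast_le.2 ?_
    refine card_le_card_of_injOn (fun y => y 0) (fun y hy => ?_) (fun y hy z hz h => ?_)
    · simp only [coe_filter, Set.mem_ofPred_eq] at hy
      obtain ⟨hy, rfl⟩ := hy
      simpa [D] using hy
    · simp only [coe_filter, Set.mem_ofPred_eq] at hy hz
      rw [← Fin.cons_self_tail y, ← Fin.cons_self_tail z, hy.2, hz.2]
      simp only at h
      rw [h]
  rw [h1]
  have h3 := pow_sum_div_card_le_sum_pow (s := (univ : Finset (Fin s → V)))
    (f := fun x => (#(D x) : ℝ)) (fun _ _ => by positivity) t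
  refine le_trans ?_ h3
  rw [le_div_iff₀ (by simp; positivity)]
  calc c ^ (t + 1) * n ^ (s + (t + 1)) * (#(univ : Finset (Fin s → V)) : ℝ) ^ t
      = (c * n ^ (s + 1)) ^ (t + 1) := by simp [n]; ring
    _ ≤ _ := by gcongr; exact hS.trans h2

theorem exists_blowup (t s : ℕ) : ∀ c : ℝ, 0 < c → ∀ f : ℕ, ∃ n₀ : ℕ, ∀ (V : Type) [Fintype V],
    n₀ ≤ Fintype.card V → ∀ F : Finset V, #F ≤ f → ∀ S : Finset (Fin s → V),
    c * (Fintype.card V : ℝ) ^ s ≤ #S → ∃ Y : Fin s → Fin (t + 1) → V,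
      (∀ i j i' j', Y i j = Y i' j' → i = i' ∧ j = j') ∧ (∀ i j, Y i j ∉ F) ∧
      ∀ g : Fin s → Fin (t + 1), (fun i => Y i (g i)) ∈ S := by
  induction s with
  | zero =>
    intro c hc f
    refine ⟨0, fun V _ _ F _ S hS => ⟨fun i => i.elim0, fun i => i.elim0, fun i => i.elim0,
      fun g => ?_⟩⟩
    have : S.Nonempty := by
      rw [← card_pos, ← Nat.cast_pos (α := ℝ)]
      exact lt_of_lt_of_le hc (by simpa using hS)
    obtain ⟨x, hx⟩ := this
    convert hx
  | succ s ih =>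
    intro c hc f
    set c' := c ^ (t + 1) / 2
    have hc' : 0 < c' := by positivity
    obtain ⟨n₁, hn₁⟩ := ih c' hc' (f + (t + 1))
    obtain ⟨n₂, hn₂⟩ := exists_nat_gt (((t + 1 : ℕ) * (f + (t + 1) : ℕ) : ℝ) / c')
    refine ⟨max n₁ (max n₂ (f + t + 2)), fun V _ hV F hF S hS => ?_⟩
    simp only [max_le_iff] at hV
    obtain ⟨hV₁, hV₂, hV₃⟩ := hV
    have : Nonempty V := Fintype.card_pos_iff.1 (by omega)
    set n : ℝ := (Fintype.card V : ℝ)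
    have hn0 : 0 < n := by simpa [n] using Fintype.card_pos
    let N : (Fin (t + 1) → V) → Finset (Fin s → V) := fun v =>
      univ.filter fun x : Fin s → V => ∀ j, (Fin.cons (v j) x : Fin (s + 1) → V) ∈ S
    have hsum : c ^ (t + 1) * n ^ (s + (t + 1)) ≤ ∑ v, (#(N v) : ℝ) :=
      le_sum_card_common t s hc.le S hS
    obtain ⟨v, hv, hvF, hvN⟩ : ∃ v : Fin (t + 1) → V, Function.Injective v ∧ (∀ i, v i ∉ F) ∧
        c' * n ^ s ≤ #(N v) := by
      by_contra! hcon
      set G := univ.filter fun v : Fin (t + 1) → V => Function.Injective v ∧ ∀ i, v i ∉ F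
      have hG : n ^ (t + 1) - c' * n ^ (t + 1) < #G := by
        have h1 := card_injective_avoiding (t + 1) F
        have h2 : ((n - (f + (t + 1) : ℕ)) : ℝ) ^ (t + 1) ≤ #G := by
          refine le_trans ?_ (Nat.cast_le.2 h1)
          push_cast
          have h3 : ((Fintype.card V + 1 - #F - (t + 1) : ℕ) : ℝ) = n + 1 - #F - (t + 1) := by
            rw [Nat.cast_sub (by omega), Nat.cast_sub (by omega)]
            push_cast; rfl
          have h4 : (#F : ℝ) ≤ f := by exact_mod_cast hF
          have h5 : ((f + t + 2 : ℕ) : ℝ) ≤ n := Nat.cast_le.2 hV₃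
          push_cast at h5
          rw [h3]
          exact pow_le_pow_left₀ (by linarith) (by linarith) _
        refine lt_of_lt_of_le ?_ h2
        have h5 : ((f + t + 2 : ℕ) : ℝ) ≤ n := Nat.cast_le.2 hV₃
        push_cast at h5
        have h6 := one_add_mul_le_pow (a := -((f + (t + 1) : ℕ) / n)) (by
          push_cast
          have : (f + (t + 1 : ℝ)) / n ≤ 1 := by rw [div_le_one hn0]; linarith
          linarith) (t + 1)
        have h7 : (n - (f + (t + 1) : ℕ)) = n * (1 + -((f + (t + 1) : ℕ) / n)) := by
          field_simp; ring
        rw [h7, mul_pow]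
        have h8 : ((t + 1 : ℕ) * (f + (t + 1) : ℕ) : ℝ) / n < c' := by
          rw [div_lt_iff₀ hn0]
          rw [div_lt_iff₀ hc'] at hn₂
          have : (n₂ : ℝ) ≤ n := Nat.cast_le.2 hV₂
          nlinarith
        have h9 : 1 - c' < (1 + -((f + (t + 1) : ℕ) / n)) ^ (t + 1) := by
          refine lt_of_lt_of_le ?_ h6
          rw [mul_div_assoc] at h8
          linarith
        have h10 : 0 < n ^ (t + 1) := by positivity
        nlinarith
      have hle : ∑ v, (#(N v) : ℝ) ≤ ∑ v : Fin (t + 1) → V,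
          ((if v ∈ G then c' * n ^ s else 0) + if v ∈ Gᶜ then n ^ s else 0) := by
        refine sum_le_sum fun v _ => ?_
        by_cases hvG : v ∈ G
        · have hvG' := hvG
          simp only [G, mem_filter, mem_univ, true_and] at hvG'
          simpa [hvG] using (hcon v hvG'.1 hvG'.2).le
        · have : (#(N v) : ℝ) ≤ Fintype.card (Fin s → V) := by exact_mod_cast card_le_univ _
          simpa [hvG] using this
      rw [sum_add_distrib, sum_ite_mem, sum_ite_mem, univ_inter, univ_inter, sum_const, sum_const,
        nsmul_eq_mul, nsmul_eq_mul] at hle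
      have hGc : (#G : ℝ) + #Gᶜ = n ^ (t + 1) := by
        have := card_add_card_compl G
        rw [Fintype.card_fun, Fintype.card_fin] at this
        rw [← Nat.cast_add, this, Nat.cast_pow]
      have h1 : c ^ (t + 1) = 2 * c' := by simp only [c']; ring
      rw [h1, pow_add] at hsum
      have h2 : 0 < n ^ s := by positivity
      have h3 : (#G : ℝ) ≤ n ^ (t + 1) := hGc ▸ le_add_of_nonneg_right (Nat.cast_nonneg _)
      have h4 : (#G : ℝ) * (c' * n ^ s) ≤ n ^ (t + 1) * (c' * n ^ s) := by gcongr
      have h5 : (#Gᶜ : ℝ) * n ^ s < c' * n ^ (t + 1) * n ^ s := by gcongr; linarith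
      nlinarith
    obtain ⟨Y, hY₁, hY₂, hY₃⟩ := hn₁ V hV₁ (F ∪ univ.image v)
      ((card_union_le _ _).trans (add_le_add hF (card_image_le.trans (by simp)))) (N v) hvN
    simp only [mem_union, mem_image, mem_univ, true_and, not_or, not_exists] at hY₂
    refine ⟨Fin.cons v Y, ?_, ?_, ?_⟩
    · intro i j i' j' h
      induction i using Fin.cases <;> induction i' using Fin.cases
      · simpa using hv h
      · exact absurd h ((hY₂ _ _).2 _)
      · exact absurd h.symm ((hY₂ _ _).2 _)
      · simpa using hY₁ _ _ _ _ h
    · intro i j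
      induction i using Fin.cases
      · exact hvF j
      · exact (hY₂ _ _).1
    · intro g
      have := hY₃ fun i => g i.succ
      simp only [N, mem_filter, mem_univ, true_and] at this
      convert this (g 0) using 1
      ext i
      induction i using Fin.cases <;> simp

end Supersaturation

section Cycles

variable {V : Type*}

/-- `R` contains a directed cycle of length `ℓ`. -/
def HasCycle (R : V → V → Prop) (ℓ : ℕ) : Prop :=
  ∃ v : ZMod ℓ → V, Function.Injective v ∧ ∀ i, R (v i) (v (i + 1))

theorem fin_add_one_cases {t : ℕ} {P : ℕ → ℕ → Prop} (h : ∀ i < t, P i (i + 1)) (h' : P t 0)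
    (i : Fin (t + 1)) : P i (i + 1 : Fin (t + 1)) := by
  rw [Fin.val_add_one]
  split_ifs with hi
  · subst hi; exact h'
  · exact h _ (by have := Fin.val_lt_last hi; simpa using this)

theorem hasCycle_of_fun {R : V → V → Prop} {t : ℕ} {p : ℕ → V}
    (hp : ∀ i ≤ t, ∀ j ≤ t, p i = p j → i = j) (hR : ∀ i < t, R (p i) (p (i + 1)))
    (h0 : R (p t) (p 0)) : HasCycle R (t + 1) := by
  refine ⟨fun i : Fin (t + 1) => p i, fun i j h => ?_, ?_⟩
  · exact Fin.ext (hp _ (Nat.lt_succ_iff.1 i.2) _ (Nat.lt_succ_iff.1 j.2) h)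
  · exact fin_add_one_cases (P := fun a b => R (p a) (p b)) hR h0

end Cycles

section Sampling

theorem sum_weight_eq {V : Type} [Fintype V] {s : ℕ} (i : Fin s) (v : V) {N : Finset V}
    (hv : v ∉ N) (t : ℝ) :
    ∑ x : Fin s → V with x i = v, ∏ j, (if x j ∈ N then t else 1) =
      (Fintype.card V - (1 - t) * #N) ^ (s - 1) := by
  have h := prod_univ_sum (fun j : Fin s => if j = i then ({v} : Finset V) else univ)
    fun _ a => if a ∈ N then t else (1 : ℝ)
  have h1 : (Fintype.piFinset fun j : Fin s => if j = i then ({v} : Finset V) else univ) =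
      univ.filter fun x : Fin s → V => x i = v := by
    ext x
    simp only [Fintype.mem_piFinset, mem_filter, mem_univ, true_and]
    refine ⟨fun h => by simpa using h i, fun h j => ?_⟩
    split_ifs with hj
    · simp [hj, h]
    · simp
  rw [h1] at h
  rw [← h, Fintype.prod_eq_mul_prod_compl i]
  have h2 : ∀ j ∈ ({i}ᶜ : Finset (Fin s)),
      ∑ a ∈ (if j = i then ({v} : Finset V) else univ), (if a ∈ N then t else (1 : ℝ)) =
        Fintype.card V - (1 - t) * #N := by
    intro j hj
    rw [if_neg (by simpa using hj)]
    have : ∀ a : V, (if a ∈ N then t else (1 : ℝ)) = 1 - if a ∈ N then 1 - t else 0 := by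
      intro a; split_ifs <;> ring
    simp only [this, sum_sub_distrib, sum_ite_mem, univ_inter, sum_const, nsmul_eq_mul, card_univ]
    ring
  rw [prod_congr rfl h2, prod_const, card_compl, card_singleton, Fintype.card_fin]
  simp [hv]

/-- Few samples of `73 * r` vertices have an entry with fewer than `18 * r` neighbours among the
entries, if all neighbourhoods contain at least a quarter of the vertices. -/
theorem card_bad_samples_le {V : Type} [Fintype V] {N : V → Finset V} (hN : ∀ v, v ∉ N v)
    (hd : ∀ v, (Fintype.card V : ℝ) / 4 ≤ #(N v)) {s r : ℕ} (hs : s = 73 * r) (hr : 0 < r)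
    (i : Fin s) :
    (#(univ.filter fun x : Fin s → V => #(univ.filter fun j => x j ∈ N (x i)) < 18 * r) : ℝ) ≤
      Fintype.card V ^ s * ((995 / 1000 : ℝ)⁻¹ *
        ((995 / 1000 : ℝ) ^ 73 * ((98 / 100 : ℝ) ^ 18)⁻¹) ^ r) := by
  set n : ℝ := (Fintype.card V : ℝ)
  set B := univ.filter fun x : Fin s → V => #(univ.filter fun j => x j ∈ N (x i)) < 18 * r
  have hv : ∀ v, (#(B.filter fun x => x i = v) : ℝ) * (98 / 100 : ℝ) ^ (18 * r) ≤
      (n * (995 / 1000)) ^ (s - 1) := by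
    intro v
    calc (#(B.filter fun x => x i = v) : ℝ) * (98 / 100 : ℝ) ^ (18 * r)
        = ∑ x ∈ B.filter fun x => x i = v, (98 / 100 : ℝ) ^ (18 * r) := by simp
      _ ≤ ∑ x ∈ B.filter fun x => x i = v, ∏ j, (if x j ∈ N v then 98 / 100 else (1 : ℝ)) := by
          refine sum_le_sum fun x hx => ?_
          simp only [B, mem_filter, mem_univ, true_and] at hx
          rw [← prod_filter, prod_const]
          rw [← hx.2]
          exact pow_le_pow_of_le_one (by norm_num) (by norm_num) hx.1.le
      _ ≤ ∑ x : Fin s → V with x i = v, ∏ j, (if x j ∈ N v then 98 / 100 else (1 : ℝ)) := by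
          refine sum_le_sum_of_subset_of_nonneg (filter_subset_filter _ (subset_univ _)) ?_
          intro x _ _
          refine prod_nonneg fun j _ => ?_
          split_ifs <;> norm_num
      _ = (n - (1 - 98 / 100) * #(N v)) ^ (s - 1) := sum_weight_eq i v (hN v) _
      _ ≤ (n * (995 / 1000)) ^ (s - 1) := by
          have h1 : (#(N v) : ℝ) ≤ n := Nat.cast_le.2 (card_le_univ _)
          have h2 : n / 4 ≤ #(N v) := hd v
          have h3 : 0 ≤ n := Nat.cast_nonneg _
          refine pow_le_pow_left₀ ?_ ?_ _ <;> linarith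
  have hB : (#B : ℝ) = ∑ v, (#(B.filter fun x => x i = v) : ℝ) := by
    rw [card_eq_sum_card_fiberwise (f := fun x => x i) (t := univ) (by intro; simp)]
    push_cast
    rfl
  have hsum : (#B : ℝ) * (98 / 100 : ℝ) ^ (18 * r) ≤ n * (n * (995 / 1000)) ^ (s - 1) := by
    rw [hB, sum_mul]
    refine (sum_le_sum fun v _ => hv v).trans ?_
    simp [n]
  have h1 : n * (n * (995 / 1000)) ^ (s - 1) = n ^ s * (995 / 1000) ^ s * (995 / 1000 : ℝ)⁻¹ := by
    obtain ⟨s', rfl⟩ : ∃ s', s = s' + 1 := ⟨s - 1, by omega⟩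
    rw [Nat.add_sub_cancel, mul_pow, pow_succ, pow_succ]
    field_simp
  rw [h1, ← le_div_iff₀ (by positivity)] at hsum
  refine hsum.trans (le_of_eq ?_)
  conv_lhs => rw [show ((995 / 1000 : ℝ)) ^ s = (995 / 1000 : ℝ) ^ (73 * r) by rw [hs]]
  rw [pow_mul, pow_mul, mul_pow, inv_pow]
  ring

/-- The pairs of adjacent neighbours, encoded as triples of pairwise adjacent vertices. -/
noncomputable def triangles {V : Type*} [Fintype V] (R : V → V → Prop) : Finset (V × V × V) :=
  univ.filter fun a => R a.1 a.2.1 ∧ R a.2.1 a.2.2 ∧ (R a.1 a.2.2 ∨ R a.2.2 a.1)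

theorem card_triangles_mul_le {V : Type} [Fintype V] (R : V → V → Prop) (s : ℕ) :
    #(triangles R) * Fintype.card V ^ s ≤ #(univ.filter fun x : Fin (s + 3) → V =>
      R (x 0) (x 1) ∧ R (x 1) (x 2) ∧ (R (x 0) (x 2) ∨ R (x 2) (x 0))) := by
  have : #(triangles R) * Fintype.card V ^ s =
      #(triangles R ×ˢ (univ : Finset (Fin s → V))) := by
    rw [card_product, card_univ, Fintype.card_fun, Fintype.card_fin]
  rw [this]
  refine card_le_card_of_injOn (fun a => (Fin.cons a.1.1 (Fin.cons a.1.2.1 (Fin.cons a.1.2.2 a.2 :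
    Fin (s + 1) → V) : Fin (s + 2) → V) : Fin (s + 3) → V)) (fun a ha => ?_) (fun a _ b _ h => ?_)
  · simp only [coe_product, Set.mem_prod, mem_coe, triangles, mem_filter, mem_univ, true_and,
      and_true] at ha
    exact mem_filter.2 ⟨mem_univ _, ha⟩
  · simp only [Fin.cons_inj] at h
    obtain ⟨h1, h2, h3, h4⟩ := h
    ext <;> simp [*]

theorem exists_sample_size {c : ℝ} (hc : 0 < c) : ∃ r : ℕ, 0 < r ∧
    ((2 * (73 * r) : ℕ) : ℝ) * ((995 / 1000 : ℝ)⁻¹ *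
        ((995 / 1000 : ℝ) ^ 73 * ((98 / 100 : ℝ) ^ 18)⁻¹) ^ r) < c := by
  have h := (tendsto_self_mul_const_pow_of_lt_one
    (r := (995 / 1000 : ℝ) ^ 73 * ((98 / 100 : ℝ) ^ 18)⁻¹) (by positivity)
    (by norm_num)).const_mul (146 * (995 / 1000 : ℝ)⁻¹)
  rw [mul_zero] at h
  obtain ⟨r, hr, hr0⟩ := ((h.eventually (gt_mem_nhds hc)).and
    (Filter.eventually_gt_atTop 0)).exists
  refine ⟨r, hr0, lt_of_eq_of_lt ?_ hr⟩
  push_cast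
  ring

/-- A large oriented graph with minimum semidegree at least a quarter of its order and a positive
density of triangles contains an `ℓ`-cycle. -/
theorem card_triangles_lt {ℓ : ℕ} (hℓ : 4 ≤ ℓ) (hmod : ℓ % 12 = 3) {c : ℝ} (hc : 0 < c) :
    ∃ n₀ : ℕ, ∀ (V : Type) [Fintype V], n₀ ≤ Fintype.card V → ∀ R : V → V → Prop,
      (∀ u v, R u v → ¬ R v u) → (∀ v, (Fintype.card V : ℝ) / 4 ≤ #(outN R v)) →
      (∀ v, (Fintype.card V : ℝ) / 4 ≤ #(inN R v)) → ¬ HasCycle R ℓ →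
      (#(triangles R) : ℝ) < c * Fintype.card V ^ 3 := by
  obtain ⟨r, hr, hrc⟩ := exists_sample_size (half_pos hc)
  obtain ⟨s, hs⟩ : ∃ s, s + 3 = 73 * r := ⟨73 * r - 3, by omega⟩
  obtain ⟨t, rfl⟩ : ∃ t, ℓ = t + 1 := ⟨ℓ - 1, by omega⟩
  obtain ⟨n₀, hn₀⟩ := exists_blowup t (s + 3)
    (c / 2 / ((s + 3 : ℕ) ^ (t + 1) : ℕ)) (by positivity) 0
  refine ⟨n₀, fun V _ hV R hR hout hin hno => ?_⟩
  by_contra! htri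
  set n : ℝ := (Fintype.card V : ℝ)
  set q : ℝ := (995 / 1000 : ℝ)⁻¹ * ((995 / 1000 : ℝ) ^ 73 * ((98 / 100 : ℝ) ^ 18)⁻¹) ^ r
  have hirr : ∀ v, ¬ R v v := fun v h => hR v v h h
  set T := univ.filter fun x : Fin (s + 3) → V =>
      R (x 0) (x 1) ∧ R (x 1) (x 2) ∧ (R (x 0) (x 2) ∨ R (x 2) (x 0))
  have hT : c * n ^ (s + 3) ≤ #T := by
    have : ((#(triangles R) * Fintype.card V ^ s : ℕ) : ℝ) ≤ #T :=
      Nat.cast_le.2 (card_triangles_mul_le R s)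
    refine le_trans ?_ this
    push_cast
    calc c * n ^ (s + 3) = c * n ^ 3 * n ^ s := by ring
      _ ≤ _ := by gcongr
  let Bo : Fin (s + 3) → Finset (Fin (s + 3) → V) := fun i =>
    univ.filter fun x => #(univ.filter fun j => x j ∈ outN R (x i)) < 18 * r
  let Bi : Fin (s + 3) → Finset (Fin (s + 3) → V) := fun i =>
    univ.filter fun x => #(univ.filter fun j => x j ∈ inN R (x i)) < 18 * r
  set B := univ.biUnion fun i => Bo i ∪ Bi i
  have hB : (#B : ℝ) ≤ c / 2 * n ^ (s + 3) := by
    have h1 : (#B : ℝ) ≤ ∑ _i : Fin (s + 3), (n ^ (s + 3) * q + n ^ (s + 3) * q) := by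
      refine (Nat.cast_le.2 card_biUnion_le).trans ?_
      push_cast
      refine sum_le_sum fun i _ => (Nat.cast_le.2 (card_union_le _ _)).trans ?_
      push_cast
      exact add_le_add (card_bad_samples_le (by simp [hirr]) hout hs hr i)
        (card_bad_samples_le (by simp [hirr]) hin hs hr i)
    rw [sum_const, card_univ, Fintype.card_fin, nsmul_eq_mul] at h1
    rw [← hs] at hrc
    have h2 : 0 ≤ n ^ (s + 3) := by positivity
    push_cast at h1 hrc
    nlinarith
  have hTB : c / 2 * n ^ (s + 3) ≤ #(T \ B) := by
    have h1 : #T ≤ #B + #(T \ B) := by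
      rw [← card_inter_add_card_sdiff T B]
      gcongr
      exact inter_subset_right
    have h2 : (#T : ℝ) ≤ #B + #(T \ B) := by exact_mod_cast h1
    linarith
  let S : (Fin (t + 1) → Fin (s + 3)) → Finset (Fin (s + 3) → V) := fun W =>
    univ.filter fun x => ∀ i, R (x (W i)) (x (W (i + 1)))
  have hcover : T \ B ⊆ univ.biUnion S := by
    intro x hx
    simp only [mem_sdiff, B, mem_biUnion, mem_univ, true_and, mem_union, Bo, Bi, mem_filter,
      not_exists, not_or, not_lt, T, mem_outN, mem_inN] at hx
    obtain ⟨hx, hxB⟩ := hx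
    obtain ⟨v, hv⟩ := exists_closed_walk (R := fun a b => R (x a) (x b)) (δ := 18 * r)
      (fun u v => hR _ _) (fun v => (hxB v).1) (fun v => (hxB v).2)
      (by rw [Fintype.card_fin]; omega) hℓ hmod hx.1 hx.2.1 hx.2.2
    obtain ⟨f, f0, fl, hf⟩ := hv.exists_fun
    simp only [mem_biUnion, mem_univ, true_and, S, mem_filter]
    refine ⟨fun i => f i, fin_add_one_cases (P := fun a b => R (x (f a)) (x (f b)))
      (fun i hi => hf i (by omega)) ?_⟩
    have := hf t (by omega)
    rwa [fl, ← f0] at this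
  obtain ⟨W, -, hW⟩ : ∃ W ∈ (univ : Finset (Fin (t + 1) → Fin (s + 3))),
      c / 2 / ((s + 3 : ℕ) ^ (t + 1) : ℕ) * n ^ (s + 3) ≤ #(S W) := by
    refine exists_le_of_sum_le univ_nonempty ?_
    rw [sum_const, card_univ, Fintype.card_fun, Fintype.card_fin, Fintype.card_fin, nsmul_eq_mul]
    calc (((s + 3) ^ (t + 1) : ℕ) : ℝ) * (c / 2 / ((s + 3) ^ (t + 1) : ℕ) * n ^ (s + 3))
        = c / 2 * n ^ (s + 3) := by field_simp
      _ ≤ #(T \ B) := hTB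
      _ ≤ ∑ W, (#(S W) : ℝ) := by
          exact_mod_cast (card_le_card hcover).trans card_biUnion_le
  obtain ⟨Y, hY, -, hYS⟩ := hn₀ V hV ∅ (by simp) (S W) hW
  simp only [S, mem_filter, mem_univ, true_and] at hYS
  refine hno ⟨fun i : Fin (t + 1) => Y (W i) i, fun i j h => (hY _ _ _ _ h).2,
    fun i : Fin (t + 1) => ?_⟩
  have hne : W (i + 1) ≠ W i := fun h => by
    have := hYS (fun _ => 0) i
    rw [h] at this
    exact hirr _ this
  have := hYS (fun a => if a = W i then i else i + 1) i
  simp only [hne, if_true, if_false] at this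
  exact this

end Sampling

section Bipartition

theorem card_heavy_le {β : Type*} {B : Finset β} {d : β → ℕ} {q r : ℕ}
    (h : ∑ b ∈ B, d b ≤ q * (r + 1)) : #(B.filter fun b => r < d b) ≤ q := by
  have h1 : #(B.filter fun b => r < d b) * (r + 1) ≤ q * (r + 1) := by
    refine le_trans ?_ h
    refine le_trans ?_ (sum_le_sum_of_subset (filter_subset (fun b => r < d b) B))
    rw [← smul_eq_mul]
    exact card_nsmul_le_sum _ _ _ fun b hb => (mem_filter.1 hb).2
  exact Nat.le_of_mul_le_mul_right h1 (Nat.succ_pos r)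

/-- If every element of `A` is related to few elements of `B`, then most elements of `B` are
related to few elements of `A`. -/
theorem card_heavy_le_of_forall {α β : Type*} {A : Finset α} {B : Finset β} (P : α → β → Prop)
    [∀ a b, Decidable (P a b)] {m p e : ℕ} (h : ∀ a ∈ A, #(B.filter (P a)) ≤ p) (hA : #A ≤ m)
    (hm : m * p ≤ e ^ 2) :
    #(B.filter fun b => e < #(A.filter fun a => P a b)) ≤ e := by
  refine card_heavy_le ?_
  have := sum_card_bipartiteAbove_eq_sum_card_bipartiteBelow (s := A) (t := B) P
  simp only [bipartiteAbove, bipartiteBelow] at this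
  rw [← this]
  calc ∑ a ∈ A, #(B.filter (P a)) ≤ #A * p := by
        rw [← smul_eq_mul]; exact sum_le_card_nsmul _ _ _ h
    _ ≤ m * p := by gcongr
    _ ≤ e * (e + 1) := by nlinarith

variable {V : Type*} [Fintype V]

/-- The set of all neighbours of `v`. -/
noncomputable def nbrs (R : V → V → Prop) (v : V) : Finset V := outN R v ∪ inN R v

variable {R : V → V → Prop}

@[simp] theorem mem_nbrs {v w : V} : w ∈ nbrs R v ↔ R v w ∨ R w v := by simp [nbrs]

theorem mem_nbrs_comm {v w : V} : w ∈ nbrs R v ↔ v ∈ nbrs R w := by simp [or_comm]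

theorem nbrs_flip (v : V) : nbrs (fun a b => R b a) v = nbrs R v := by
  ext; simp [or_comm]

theorem card_nbrs (hR : ∀ u v, R u v → ¬ R v u) (v : V) :
    #(nbrs R v) = #(outN R v) + #(inN R v) := by
  refine card_union_of_disjoint (disjoint_left.2 fun w h h' => ?_)
  exact hR _ _ (mem_outN.1 h) (mem_inN.1 h')

/-- The edges between neighbours of `v`. -/
noncomputable def link (R : V → V → Prop) (v : V) : Finset (V × V) :=
  univ.filter fun a => a.1 ∈ nbrs R v ∧ a.2 ∈ nbrs R v ∧ R a.1 a.2

theorem sum_card_link_le : ∑ v, #(link R v) ≤ 3 * #(triangles R) := by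
  rw [← card_sigma]
  set S := (univ : Finset V).sigma fun v => link R v
  have h1 : #(S.filter fun a => R a.1 a.2.1) ≤ #(triangles R) := by
    refine card_le_card_of_injOn (fun a => (a.1, a.2.1, a.2.2)) (fun a ha => ?_) ?_
    · simp [S, link, triangles] at ha ⊢; tauto
    · rintro ⟨a, b, c⟩ _ ⟨a', b', c'⟩ _ h
      simpa using h
  have h2 : #(S.filter fun a => R a.2.1 a.1 ∧ R a.2.2 a.1) ≤ #(triangles R) := by
    refine card_le_card_of_injOn (fun a => (a.2.1, a.2.2, a.1)) (fun a ha => ?_) ?_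
    · simp [S, link, triangles] at ha ⊢; tauto
    · rintro ⟨a, b, c⟩ _ ⟨a', b', c'⟩ _ h
      simp at h ⊢; tauto
  have h3 : #(S.filter fun a => R a.2.1 a.1 ∧ R a.1 a.2.2) ≤ #(triangles R) := by
    refine card_le_card_of_injOn (fun a => (a.2.1, a.1, a.2.2)) (fun a ha => ?_) ?_
    · simp [S, link, triangles] at ha ⊢; tauto
    · rintro ⟨a, b, c⟩ _ ⟨a', b', c'⟩ _ h
      simp at h ⊢; tauto
  have h4 : S ⊆ (S.filter fun a => R a.1 a.2.1) ∪ (S.filter fun a => R a.2.1 a.1 ∧ R a.2.2 a.1) ∪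
      S.filter fun a => R a.2.1 a.1 ∧ R a.1 a.2.2 := by
    intro a ha
    have : a.2 ∈ link R a.1 := (mem_sigma.1 ha).2
    simp only [link, mem_filter, mem_nbrs] at this
    simp only [mem_union, mem_filter]
    tauto
  have := card_le_card h4
  have := card_union_le ((S.filter fun a => R a.1 a.2.1) ∪
    (S.filter fun a => R a.2.1 a.1 ∧ R a.2.2 a.1)) (S.filter fun a => R a.2.1 a.1 ∧ R a.1 a.2.2)
  have := card_union_le (S.filter fun a => R a.1 a.2.1)
    (S.filter fun a => R a.2.1 a.1 ∧ R a.2.2 a.1)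
  omega

/-- Most vertices of a subset of the neighbourhood of `v` have few neighbours inside the subset if
there are few edges between neighbours of `v`. -/
theorem card_heavy_nbrs_le (hR : ∀ u v, R u v → ¬ R v u) {v : V} {S : Finset V}
    (hS : S ⊆ nbrs R v) {e : ℕ} (h : 2 * #(link R v) ≤ e ^ 2) :
    #(S.filter fun y => e < #(S ∩ nbrs R y)) ≤ e := by
  refine card_heavy_le ?_
  have h1 : ∑ y ∈ S, #(S ∩ nbrs R y) = ∑ y ∈ S, #(outN R y ∩ S) + ∑ y ∈ S, #(inN R y ∩ S) := by
    rw [← sum_add_distrib]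
    refine sum_congr rfl fun y _ => ?_
    rw [inter_comm, nbrs, union_inter_distrib_right, card_union_of_disjoint]
    refine disjoint_left.2 fun w h h' => ?_
    simp only [mem_inter, mem_outN, mem_inN] at h h'
    exact hR _ _ h.1 h'.1
  have h2 : ∑ y ∈ S, #(outN R y ∩ S) ≤ #(link R v) := by
    rw [← card_sigma]
    refine card_le_card_of_injOn (fun a => (a.1, a.2)) (fun a ha => ?_) ?_
    · simp only [coe_sigma, Set.mem_sigma_iff, mem_coe, mem_inter, mem_outN] at ha
      simp only [link, coe_filter, mem_univ, true_and, Set.mem_ofPred_eq]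
      exact ⟨hS ha.1, hS ha.2.2, ha.2.1⟩
    · rintro ⟨a, b⟩ _ ⟨a', b'⟩ _ h
      simpa using h
  rw [h1, ← sum_card_outN_inter]
  nlinarith

/-- The underlying graph of `R` is close to the complete bipartite graph with classes `X`, `Y`. -/
structure NearBipartite (R : V → V → Prop) (e : ℕ) (X Y : Finset V) : Prop where
  disjoint : Disjoint X Y
  card_compl : #(X ∪ Y)ᶜ ≤ e
  cross_left : ∀ x ∈ X, #(Y \ nbrs R x) ≤ e
  cross_right : ∀ y ∈ Y, #(X \ nbrs R y) ≤ e
  inner_left : ∀ x ∈ X, #(X ∩ nbrs R x) ≤ e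
  inner_right : ∀ y ∈ Y, #(Y ∩ nbrs R y) ≤ e

theorem NearBipartite.symm {e : ℕ} {X Y : Finset V} (h : NearBipartite R e X Y) :
    NearBipartite R e Y X :=
  ⟨h.1.symm, union_comm X Y ▸ h.2, h.4, h.3, h.6, h.5⟩

theorem NearBipartite.flip {e : ℕ} {X Y : Finset V} (h : NearBipartite R e X Y) :
    NearBipartite (fun a b => R b a) e X Y :=
  ⟨h.1, h.2, by simpa only [nbrs_flip] using h.3, by simpa only [nbrs_flip] using h.4,
    by simpa only [nbrs_flip] using h.5, by simpa only [nbrs_flip] using h.6⟩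

theorem exists_nearBipartite (hR : ∀ u v, R u v → ¬ R v u)
    (hdeg : ∀ v, Fintype.card V + 1 ≤ 2 * #(nbrs R v)) {f e₁ e₂ e : ℕ} (hf : 0 < f)
    (htri : 12 * #(triangles R) ≤ f * Fintype.card V ^ 2)
    (h₁ : 2 * (f * Fintype.card V) ≤ e₁ ^ 2) (h₂ : Fintype.card V * e₁ ≤ e₂ ^ 2)
    (hn : 0 < Fintype.card V) (h₃ : 8 * e₁ ≤ Fintype.card V) (he : 3 * e₁ + e₂ ≤ e) :
    ∃ X Y : Finset V, NearBipartite R e X Y := by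
  set n := Fintype.card V
  set B := univ.filter fun v => f * n < #(link R v)
  have hB : 4 * #B ≤ n := by
    have h1 : #B * (f * n) ≤ 3 * #(triangles R) := by
      refine le_trans ?_ sum_card_link_le
      refine le_trans ?_ (sum_le_sum_of_subset (subset_univ B))
      rw [← smul_eq_mul]
      exact card_nsmul_le_sum _ _ _ fun b hb => (mem_filter.1 hb).2.le
    have h2 : (f * n) * (4 * #B) ≤ (f * n) * n := by nlinarith
    exact Nat.le_of_mul_le_mul_left h2 (by positivity)
  have hlink : ∀ v, v ∉ B → 2 * #(link R v) ≤ e₁ ^ 2 := by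
    intro v hv
    simp only [B, mem_filter, mem_univ, true_and, not_lt] at hv
    omega
  obtain ⟨v₀, hv₀⟩ : ∃ v, v ∉ B := by
    by_contra! h
    have : B = univ := eq_univ_of_forall h
    rw [this, card_univ] at hB
    omega
  have hY := card_heavy_nbrs_le hR (subset_refl (nbrs R v₀)) (hlink _ hv₀)
  set Y' := nbrs R v₀
  have hY'c : n + 1 ≤ 2 * #Y' := hdeg v₀
  set Y := Y'.filter fun y => #(Y' ∩ nbrs R y) ≤ e₁
  have hYsub : Y ⊆ Y' := filter_subset _ _
  have hYc : #(Y' \ Y) ≤ e₁ := by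
    refine (card_le_card fun y hy => ?_).trans hY
    simp only [Y, mem_sdiff, mem_filter, not_and, not_le] at hy ⊢
    exact ⟨hy.1, hy.2 hy.1⟩
  have hXc : #Y'ᶜ + #Y' = n := card_compl_add_card _
  have hmiss : ∀ y ∈ Y, #(Y'ᶜ \ nbrs R y) ≤ e₁ := by
    intro y hy
    have h1 := (mem_filter.1 hy).2
    have h2 := card_inter_add_card_sdiff (nbrs R y) Y'
    have h3 := hdeg y
    have h4 : #(nbrs R y \ Y') + #(Y'ᶜ \ nbrs R y) ≤ #Y'ᶜ := by
      rw [← card_union_of_disjoint]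
      · refine card_le_card fun w => ?_
        simp only [mem_union, mem_sdiff, mem_compl]; tauto
      · exact disjoint_left.2 fun w h h' => (mem_sdiff.1 h').2 (mem_sdiff.1 h).1
    rw [inter_comm] at h2
    omega
  obtain ⟨v₁, hv₁Y, hv₁⟩ : ∃ v ∈ Y, v ∉ B := by
    by_contra! h
    have h1 := card_le_card h
    have h2 := card_sdiff_add_card_eq_card hYsub
    omega
  have hX := card_heavy_nbrs_le hR (inter_subset_right : Y'ᶜ ∩ nbrs R v₁ ⊆ nbrs R v₁)
    (hlink _ hv₁)
  set X' := Y'ᶜ ∩ nbrs R v₁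
  set X := X'.filter fun x => #(X' ∩ nbrs R x) ≤ e₁ ∧ #(Y \ nbrs R x) ≤ e₂
  have hXsub : X ⊆ X' := filter_subset _ _
  have hmiss' : #(Y'ᶜ.filter fun x => e₂ < #(Y.filter fun y => x ∉ nbrs R y)) ≤ e₂ := by
    refine card_heavy_le_of_forall (fun y x => x ∉ nbrs R y) (p := e₁) (fun y hy => ?_)
      (card_le_univ Y) h₂
    rw [filter_notMem_eq_sdiff]
    exact hmiss y hy
  refine ⟨X, Y, ?_, ?_, ?_, ?_, ?_, ?_⟩
  · refine disjoint_left.2 fun x hx hy => ?_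
    exact mem_compl.1 (mem_inter.1 (hXsub hx)).1 (hYsub hy)
  · have h1 : (X ∪ Y)ᶜ ⊆ (Y' \ Y) ∪ (Y'ᶜ \ nbrs R v₁) ∪
        (X'.filter fun y => e₁ < #(X' ∩ nbrs R y)) ∪
        (Y'ᶜ.filter fun x => e₂ < #(Y.filter fun y => x ∉ nbrs R y)) := by
      intro x hx
      simp only [mem_union, mem_sdiff, mem_compl, mem_filter, not_or, X, X', mem_inter,
        not_and, not_le] at hx ⊢
      by_cases hxY' : x ∈ Y'
      · exact Or.inl (Or.inl (Or.inl ⟨hxY', hx.2⟩))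
      by_cases hxv : x ∈ nbrs R v₁
      · by_cases h5 : #(Y'ᶜ ∩ nbrs R v₁ ∩ nbrs R x) ≤ e₁
        · refine Or.inr ⟨hxY', ?_⟩
          have h6 : (Y.filter fun y => x ∉ nbrs R y) = Y \ nbrs R x := by
            ext y
            rw [mem_filter, mem_sdiff, mem_nbrs_comm]
          rw [h6]
          exact hx.1 ⟨hxY', hxv⟩ h5
        · exact Or.inl (Or.inr ⟨⟨hxY', hxv⟩, not_le.1 h5⟩)
      · exact Or.inl (Or.inl (Or.inr ⟨hxY', hxv⟩))
    have h2 := hmiss v₁ hv₁Y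
    refine (card_le_card h1).trans ((card_union_le _ _).trans ?_)
    have h3 := card_union_le ((Y' \ Y) ∪ (Y'ᶜ \ nbrs R v₁))
      (X'.filter fun y => e₁ < #(X' ∩ nbrs R y))
    have h4 := card_union_le (Y' \ Y) (Y'ᶜ \ nbrs R v₁)
    omega
  · intro x hx
    have := (mem_filter.1 hx).2.2
    omega
  · intro y hy
    have h1 := hmiss y hy
    have h2 := card_le_card (sdiff_subset_sdiff (hXsub.trans inter_subset_left : X ⊆ Y'ᶜ)
      (subset_refl (nbrs R y)))
    omega
  · intro x hx
    have h1 := (mem_filter.1 hx).2.1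
    have h2 := card_le_card (inter_subset_inter hXsub (subset_refl (nbrs R x)))
    omega
  · intro y hy
    have h1 := (mem_filter.1 hy).2
    have h2 := card_le_card (inter_subset_inter hYsub (subset_refl (nbrs R y)))
    omega

end Bipartition

section Paths

variable {V : Type*} {R : V → V → Prop}

/-- `L` lists the vertices of a directed path from `u` to `v`. -/
structure Path (R : V → V → Prop) (L : List V) (u v : V) : Prop where
  nodup : L.Nodup
  chain : L.IsChain R
  head : L.head? = some u
  last : L.getLast? = some v

theorem Path.singleton (u : V) : Path R [u] u u := ⟨by simp, by simp, rfl, rfl⟩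

theorem Path.append {L L' : List V} {u v u' v' : V} (h : Path R L u v) (h' : Path R L' u' v')
    (hd : List.Disjoint L L') (hR : R v u') : Path R (L ++ L') u v' := by
  refine ⟨List.nodup_append'.2 ⟨h.1, h'.1, hd⟩, List.isChain_append.2 ⟨h.2, h'.2, ?_⟩, ?_, ?_⟩
  · simp [h.4, h'.3, hR]
  · simp [h.3]
  · simp [h'.4]

theorem Path.pair {u v : V} (h : R u v) (hne : u ≠ v) : Path R [u, v] u v :=
  ⟨by simp [hne], by simp [h], rfl, rfl⟩

theorem Path.hasCycle {L : List V} {u v : V} (h : Path R L u v) (hR : R v u) :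
    HasCycle R L.length := by
  obtain ⟨hn, hc, hh, hl⟩ := h
  obtain ⟨t, ht⟩ : ∃ t, L.length = t + 1 := by
    cases L
    · simp at hh
    · exact ⟨_, rfl⟩
  rw [ht]
  have hget : ∀ i (hi : i ≤ t), L.getD i u = L[i]'(by omega) := fun i hi => by
    rw [List.getD_eq_getElem]
  refine hasCycle_of_fun (p := fun i => L.getD i u) (fun i hi j hj hij => ?_) (fun i hi => ?_) ?_
  · simp only [hget i hi, hget j hj] at hij
    exact (hn.getElem_inj_iff).1 hij
  · simp only [hget i hi.le, hget (i + 1) hi]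
    exact List.isChain_iff_getElem.1 hc i (by omega)
  · simp only [hget t le_rfl, hget 0 (Nat.zero_le _)]
    rw [List.head?_eq_getElem?] at hh
    rw [List.getLast?_eq_getElem?] at hl
    rw [List.getElem?_eq_some_iff] at hh hl
    obtain ⟨_, hh⟩ := hh
    obtain ⟨_, hl⟩ := hl
    simp only [ht, Nat.add_sub_cancel] at hl
    rw [hh, hl]
    exact hR

theorem exists_mem_notMem {S Z : Finset V} {m k : ℕ} (hS : m ≤ #S) (hZ : #Z + k < m)
    {L : List V} (hL : L.length ≤ k) : ∃ w ∈ S, w ∉ Z ∧ w ∉ L := by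
  by_contra! h
  have h1 : S ⊆ Z ∪ L.toFinset := fun w hw => by
    by_cases hZ : w ∈ Z
    · exact mem_union_left _ hZ
    · exact mem_union_right _ (List.mem_toFinset.2 (h w hw hZ))
  have h2 := (card_le_card h1).trans (card_union_le _ _)
  have h3 := L.toFinset_card_le
  omega

/-- Greedy extension of a path through a sequence of vertex sets. -/
theorem Path.extend [Fintype V] {C : ℕ → Finset V} {k m : ℕ}
    (hC : ∀ i < k, ∀ u ∈ C i, m ≤ #(outN R u ∩ C (i + 1))) {Z : Finset V} {L : List V} {u v : V}
    (hL : Path R L u v) (hv : v ∈ C 0) (hm : #Z + L.length + k ≤ m) :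
    ∃ L' w, L'.length = k ∧ Path R (L ++ L') u w ∧ w ∈ C k ∧ ∀ x ∈ L', x ∉ Z := by
  induction k with
  | zero => exact ⟨[], v, rfl, by simpa using hL, hv, by simp⟩
  | succ k ih =>
    obtain ⟨L', w, hk, hp, hw, hZ⟩ := ih (fun i hi => hC i (by omega)) (by omega)
    obtain ⟨x, hx, hxZ, hxL⟩ := exists_mem_notMem (hC k (by omega) w hw)
      (Z := Z) (k := L.length + k) (by omega) (L := L ++ L') (by simp [hk])
    simp only [mem_inter, mem_outN] at hx
    refine ⟨L' ++ [x], x, by simp [hk], ?_, hx.2, ?_⟩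
    · rw [← List.append_assoc]
      exact hp.append (Path.singleton x) (by simpa [List.disjoint_singleton] using hxL) hx.1
    · intro y hy
      rcases List.mem_append.1 hy with hy | hy
      · exact hZ y hy
      · rw [List.mem_singleton.1 hy]; exact hxZ

end Paths

section OddPath

variable {V : Type*} [Fintype V] {R : V → V → Prop}

theorem NearBipartite.card_outN_le {e : ℕ} {X Y : Finset V} (h : NearBipartite R e X Y) {x : V}
    (hx : x ∈ X) : #(outN R x) ≤ #(outN R x ∩ Y) + 2 * e := by
  have h1 : outN R x ⊆ (outN R x ∩ Y) ∪ (X ∩ nbrs R x) ∪ (X ∪ Y)ᶜ := by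
    intro w hw
    simp only [mem_union, mem_inter, mem_compl, mem_nbrs, mem_outN] at hw ⊢
    tauto
  have h2 := card_le_card h1
  have h3 := card_union_le ((outN R x ∩ Y) ∪ (X ∩ nbrs R x)) (X ∪ Y)ᶜ
  have h4 := card_union_le (outN R x ∩ Y) (X ∩ nbrs R x)
  have h5 := h.inner_left x hx
  have h6 := h.card_compl
  omega

theorem NearBipartite.card_inN_le {e : ℕ} {X Y : Finset V} (h : NearBipartite R e X Y) {x : V}
    (hx : x ∈ X) : #(inN R x) ≤ #(inN R x ∩ Y) + 2 * e :=
  h.flip.card_outN_le hx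

theorem NearBipartite.exists_extend {e : ℕ} {X Y : Finset V} (h : NearBipartite R e X Y)
    (hout : ∀ v, Fintype.card V + 1 ≤ 4 * #(outN R v)) {L : List V} {u v : V} {k : ℕ}
    (hL : Path R L u v) (hv : v ∈ Y) (hk : 4 * (L.length + k) + 8 * e ≤ Fintype.card V) :
    ∃ L' w, L'.length = k ∧ Path R (L ++ L') u w ∧ w ∈ if Even k then Y else X := by
  have hC : ∀ i < k, ∀ z ∈ (if Even i then Y else X),
      L.length + k ≤ #(outN R z ∩ if Even (i + 1) then Y else X) := by
    intro i _ z hz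
    have := hout z
    by_cases hi : Even i
    · simp only [hi, Nat.even_add_one, not_true_eq_false, if_true, if_false] at hz ⊢
      have := h.symm.card_outN_le hz
      omega
    · simp only [hi, Nat.even_add_one, not_false_eq_true, if_true, if_false] at hz ⊢
      have := h.card_outN_le hz
      omega
  obtain ⟨L', w, hk, hp, hw, -⟩ := hL.extend (C := fun i => if Even i then Y else X) (Z := ∅) hC
    (by simpa using hv) (by simp)
  exact ⟨L', w, hk, hp, hw⟩

theorem NearBipartite.exists_odd_path_of_edge {e ℓ : ℕ} {X Y : Finset V}
    (h : NearBipartite R e X Y) (hR : ∀ u v, R u v → ¬ R v u)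
    (hout : ∀ v, Fintype.card V + 1 ≤ 4 * #(outN R v)) (hℓ : 8 ≤ ℓ) (hodd : Odd ℓ)
    (hn : 4 * ℓ + 8 * e ≤ Fintype.card V) {v w y : V} (hy : y ∈ Y) (hyv : R y v) (hvw : R v w)
    (hw : ∀ x ∈ X, ¬ R w x) :
    ∃ L a b, Path R L a b ∧ L.length + 3 = ℓ ∧ a ∈ Y ∧ b ∈ Y := by
  have hirr : ∀ v, ¬ R v v := fun v hv => hR v v hv hv
  obtain ⟨y', hy', hne⟩ : ∃ y' ∈ outN R w ∩ Y, y' ≠ y := by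
    refine exists_mem_ne ?_ y
    have h1 : outN R w ⊆ (outN R w ∩ Y) ∪ (X ∪ Y)ᶜ := fun z hz => by
      have := hw z
      simp only [mem_union, mem_inter, mem_compl, mem_outN] at hz ⊢
      tauto
    have h2 := (card_le_card h1).trans (card_union_le _ _)
    have h3 := h.card_compl
    have h4 := hout w
    omega
  simp only [mem_inter, mem_outN] at hy'
  have hp : Path R [y, v, w, y'] y y' := by
    refine ⟨?_, by simp [hyv, hvw, hy'.1], rfl, rfl⟩
    have h1 : y ≠ v := by rintro rfl; exact hirr _ hyv
    have h2 : y ≠ w := by rintro rfl; exact hR _ _ hyv hvw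
    have h3 : v ≠ w := by rintro rfl; exact hirr _ hvw
    have h4 : v ≠ y' := by rintro rfl; exact hR _ _ hvw hy'.1
    have h5 : w ≠ y' := by rintro rfl; exact hirr _ hy'.1
    simp [h1, h2, h3, h4, h5, hne.symm]
  obtain ⟨L', b, hk, hp', hb⟩ := h.exists_extend hout hp hy'.2 (k := ℓ - 7)
    (by simp only [List.length_cons, List.length_nil]; omega)
  rw [if_pos (by obtain ⟨m, rfl⟩ := hodd; exact ⟨m - 3, by omega⟩)] at hb
  refine ⟨_, _, _, hp', ?_, hy, hb⟩
  simp only [List.length_append, List.length_cons, List.length_nil, hk]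
  omega

theorem NearBipartite.exists_odd_path_of_pass {e ℓ : ℕ} {X Y : Finset V}
    (h : NearBipartite R e X Y) (hR : ∀ u v, R u v → ¬ R v u)
    (hout : ∀ v, Fintype.card V + 1 ≤ 4 * #(outN R v)) (hℓ : 8 ≤ ℓ) (hodd : Odd ℓ)
    (hn : 4 * ℓ + 8 * e ≤ Fintype.card V) {v x y : V} (hx : x ∈ X) (hy : y ∈ Y) (hxv : R x v)
    (hvy : R v y) : ∃ L a b, Path R L a b ∧ L.length + 3 = ℓ ∧ a ∈ X ∧ b ∈ X := by
  have hirr : ∀ v, ¬ R v v := fun v hv => hR v v hv hv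
  have hp : Path R [x, v, y] x y := by
    refine ⟨?_, by simp [hxv, hvy], rfl, rfl⟩
    have h1 : x ≠ v := by rintro rfl; exact hirr _ hxv
    have h2 : v ≠ y := by rintro rfl; exact hirr _ hvy
    have h3 : x ≠ y := fun hxy => disjoint_left.1 h.disjoint hx (hxy ▸ hy)
    simp [h1, h2, h3]
  obtain ⟨L', b, hk, hp', hb⟩ := h.exists_extend hout hp hy (k := ℓ - 6)
    (by simp only [List.length_cons, List.length_nil]; omega)
  rw [if_neg (by obtain ⟨m, rfl⟩ := hodd; rintro ⟨r, hr⟩; omega)] at hb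
  refine ⟨_, _, _, hp', ?_, hx, hb⟩
  simp only [List.length_append, List.length_cons, List.length_nil, hk]
  omega

/-- A nearly bipartite oriented graph of large minimum semidegree contains a path of prescribed odd
length (of the parity excluded by a bipartition) whose two ends lie in the same class. -/
theorem NearBipartite.exists_odd_path {e ℓ : ℕ} {X Y : Finset V}
    (h : NearBipartite R e X Y) (hR : ∀ u v, R u v → ¬ R v u)
    (hout : ∀ v, Fintype.card V + 1 ≤ 4 * #(outN R v))
    (hin : ∀ v, Fintype.card V + 1 ≤ 4 * #(inN R v)) (hℓ : 8 ≤ ℓ) (hodd : Odd ℓ)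
    (hn : 4 * ℓ + 8 * e ≤ Fintype.card V) : ∃ X Y L a b, NearBipartite R e X Y ∧ Path R L a b ∧
      L.length + 3 = ℓ ∧ a ∈ Y ∧ b ∈ Y := by
  by_cases hp : ∃ v, ∃ x ∈ X, ∃ y ∈ Y, R x v ∧ R v y
  · obtain ⟨v, x, hx, y, hy, hxv, hvy⟩ := hp
    obtain ⟨L, a, b, h'⟩ := h.exists_odd_path_of_pass hR hout hℓ hodd hn hx hy hxv hvy
    exact ⟨Y, X, L, a, b, h.symm, h'⟩
  by_cases hq : ∃ v, ∃ y ∈ Y, ∃ x ∈ X, R y v ∧ R v x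
  · obtain ⟨v, y, hy, x, hx, hyv, hvx⟩ := hq
    obtain ⟨L, a, b, h'⟩ := h.symm.exists_odd_path_of_pass hR hout hℓ hodd hn hy hx hyv hvx
    exact ⟨X, Y, L, a, b, h, h'⟩
  push Not at hp hq
  have hoXY : ∀ v, ∃ w, R v w ∧ (w ∈ X ∨ w ∈ Y) := by
    intro v
    by_contra! hcon
    have h1 : outN R v ⊆ (X ∪ Y)ᶜ := fun w hw => by
      simpa using hcon w (mem_outN.1 hw)
    have := card_le_card h1
    have := h.card_compl
    have := hout v
    omega
  have hiXY : ∀ v, ∃ w, R w v ∧ (w ∈ X ∨ w ∈ Y) := by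
    intro v
    by_contra! hcon
    have h1 : inN R v ⊆ (X ∪ Y)ᶜ := fun w hw => by
      simpa using hcon w (mem_inN.1 hw)
    have := card_le_card h1
    have := h.card_compl
    have := hin v
    omega
  -- a vertex has neighbours in at most one of the classes
  have key : ∀ X Y : Finset V, NearBipartite R e X Y → (∀ v, ∀ x ∈ X, ∀ y ∈ Y, R x v → ¬ R v y) →
      (∀ v, ∀ y ∈ Y, ∀ x ∈ X, R y v → ¬ R v x) →
      2 * #(univ.filter fun v => ∃ x ∈ X, x ∈ nbrs R v) ≤ Fintype.card V →
      (∀ v, ∃ w, R v w ∧ (w ∈ X ∨ w ∈ Y)) → (∀ v, ∃ w, R w v ∧ (w ∈ X ∨ w ∈ Y)) →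
      ∃ X Y L a b, NearBipartite R e X Y ∧ Path R L a b ∧ L.length + 3 = ℓ ∧ a ∈ Y ∧ b ∈ Y := by
    intro X Y h hp hq hc hoXY hiXY
    set S := univ.filter fun v => ∃ x ∈ X, x ∈ nbrs R v
    have main : ∀ v w, v ∉ S → w ∉ S → R v w →
        ∃ L a b, Path R L a b ∧ L.length + 3 = ℓ ∧ a ∈ Y ∧ b ∈ Y := by
      intro v w hv hw hvw
      simp only [S, mem_filter, mem_univ, true_and, mem_nbrs, not_exists, not_and, not_or]
        at hv hw
      obtain ⟨y, hyv, hy⟩ := hiXY v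
      have hy := hy.resolve_left fun hx => (hv y hx).2 hyv
      exact h.exists_odd_path_of_edge hR hout hℓ hodd hn hy hyv hvw fun x hx => (hw x hx).1
    obtain ⟨v, hv⟩ : ∃ v, v ∉ S := by
      by_contra! hall
      rw [eq_univ_of_forall hall, card_univ] at hc
      omega
    obtain ⟨w, hw, hwS⟩ : ∃ w ∈ nbrs R v, w ∉ S := by
      by_contra! hall
      have := card_le_card hall
      rw [card_nbrs hR] at this
      have := hout v
      have := hin v
      omega
    rcases mem_nbrs.1 hw with hvw | hwv
    · obtain ⟨L, a, b, h'⟩ := main v w hv hwS hvw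
      exact ⟨X, Y, L, a, b, h, h'⟩
    · obtain ⟨L, a, b, h'⟩ := main w v hwS hv hwv
      exact ⟨X, Y, L, a, b, h, h'⟩
  have hdisj : Disjoint (univ.filter fun v => ∃ x ∈ X, x ∈ nbrs R v)
      (univ.filter fun v => ∃ y ∈ Y, y ∈ nbrs R v) := by
    refine disjoint_left.2 fun v hv hv' => ?_
    simp only [mem_filter, mem_univ, true_and, mem_nbrs] at hv hv'
    obtain ⟨x, hx, hxv⟩ := hv
    obtain ⟨y, hy, hyv⟩ := hv'
    obtain ⟨w, hw, hwXY⟩ := hoXY v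
    obtain ⟨z, hz, hzXY⟩ := hiXY v
    have := hp v x hx y hy
    have := hp v x hx w
    have := hp v z
    have := hq v y hy x hx
    have := hq v y hy w
    have := hq v z
    grind
  have hcard := card_union_of_disjoint hdisj ▸ card_le_univ _
  rcases le_total (2 * #(univ.filter fun v => ∃ x ∈ X, x ∈ nbrs R v)) (Fintype.card V) with hc | hc
  · exact key X Y h hp hq hc hoXY hiXY
  · refine key Y X h.symm hq hp (by omega) ?_ ?_
    · simpa only [or_comm] using hoXY
    · simpa only [or_comm] using hiXY

end OddPath

section Frame

variable {V : Type*} [Fintype V] {R : V → V → Prop}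

/-- About a quarter of all vertices, forming `A ⊆ X`, send almost all possible edges to a set
`B ⊆ Y` of about the same size. -/
structure QuarterPair (R : V → V → Prop) (p : ℕ) (X Y A B : Finset V) : Prop where
  left_subset : A ⊆ X
  right_subset : B ⊆ Y
  card_left : Fintype.card V ≤ 4 * #A + p
  card_right : Fintype.card V ≤ 4 * #B + p
  card_right_le : 4 * #B ≤ Fintype.card V + p
  miss : ∀ a ∈ A, 4 * #(B \ outN R a) ≤ p

theorem exists_sq_ge {C p n : ℕ} (hC : 1 ≤ C) (hp : 1 ≤ p) (h : 4 * C ^ 2 * p ≤ n) :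
    ∃ q, p ≤ q ∧ n * p ≤ q ^ 2 ∧ C * q ≤ n := by
  have h1 := Nat.div_add_mod n C
  have h2 := Nat.mod_lt n hC
  have h3 : C * p ≤ C ^ 2 * p := Nat.mul_le_mul_right _ (Nat.le_self_pow two_ne_zero C)
  have h4 : C * 1 ≤ C * p := by gcongr
  have hpq : p ≤ n / C := (Nat.le_div_iff_mul_le hC).2 (by nlinarith)
  have h0 : C * 1 ≤ C * (n / C) := by gcongr; omega
  refine ⟨n / C, hpq, ?_, by omega⟩
  have h5 : n ≤ 2 * (C * (n / C)) := by omega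
  have h6 : n * (4 * C ^ 2 * p) ≤ n * n := by gcongr
  have h7 : n * n ≤ 2 * (C * (n / C)) * (2 * (C * (n / C))) := by gcongr
  have h8 : 4 * C ^ 2 * (n * p) ≤ 4 * C ^ 2 * (n / C) ^ 2 := by nlinarith
  exact Nat.le_of_mul_le_mul_left h8 (by positivity)

theorem NearBipartite.card_left_le {e : ℕ} {X Y : Finset V} (h : NearBipartite R e X Y)
    (hR : ∀ u v, R u v → ¬ R v u) (hout : ∀ v, Fintype.card V + 1 ≤ 4 * #(outN R v))
    (hin : ∀ v, Fintype.card V + 1 ≤ 4 * #(inN R v)) :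
    4 * #X ≤ 2 * Fintype.card V + 16 * e := by
  rcases X.eq_empty_or_nonempty with rfl | ⟨x, hx⟩
  · simp
  have h1 := h.card_outN_le hx
  have h2 := h.card_inN_le hx
  have h3 : #(outN R x ∩ Y) + #(inN R x ∩ Y) ≤ #Y := by
    rw [← card_union_of_disjoint]
    · exact card_le_card (union_subset inter_subset_right inter_subset_right)
    · refine disjoint_left.2 fun w hw hw' => ?_
      simp only [mem_inter, mem_outN, mem_inN] at hw hw'
      exact hR _ _ hw.1 hw'.1
  have h4 : #X + #Y ≤ Fintype.card V := by
    rw [← card_union_of_disjoint h.disjoint]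
    exact card_le_univ _
  have := hout x
  have := hin x
  omega

theorem NearBipartite.quarterPair_step {e : ℕ} {X Y A B : Finset V} (h : NearBipartite R e X Y)
    (hR : ∀ u v, R u v → ¬ R v u) (hout : ∀ v, Fintype.card V + 1 ≤ 4 * #(outN R v))
    (hin : ∀ v, Fintype.card V + 1 ≤ 4 * #(inN R v)) {p C : ℕ} (hC : 1 ≤ C) (hp : 1 ≤ p)
    (hep : e ≤ p) (hA : QuarterPair R p X Y A B)
    (hn : 4 * (29 * C) ^ 2 * p ≤ Fintype.card V) :
    ∃ p' B', p ≤ p' ∧ C * p' ≤ Fintype.card V ∧ B' ⊆ B ∧ QuarterPair R p' Y X B' (X \ A) ∧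
      ∀ b ∈ B', #(A \ inN R b) ≤ p' := by
  obtain ⟨q, hpq, hq, hCq⟩ := exists_sq_ge (by omega) hp hn
  have hqn : 29 * q ≤ Fintype.card V := by nlinarith
  have hbad := card_heavy_le_of_forall (A := A) (B := B) (fun a b => b ∉ outN R a) (p := p)
    (fun a ha => by
      rw [filter_notMem_eq_sdiff]; have := hA.miss a ha; omega) (card_le_univ A) hq
  set B' := B.filter fun b => #(A.filter fun a => b ∉ outN R a) ≤ q
  have hB' : B' ⊆ B := filter_subset _ _
  have hBB' : #(B \ B') ≤ q := by
    refine (card_le_card fun b hb => ?_).trans hbad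
    simp only [B', mem_sdiff, mem_filter, not_and, not_le] at hb ⊢
    exact ⟨hb.1, hb.2 hb.1⟩
  have hcB := card_sdiff_add_card_eq_card hB'
  have hmiss : ∀ b ∈ B', #(A \ inN R b) ≤ q := by
    intro b hb
    have h1 : (A.filter fun a => b ∉ outN R a) = A \ inN R b := by
      ext; simp
    rw [← h1]
    exact (mem_filter.1 hb).2
  have hXA := card_sdiff_add_card_eq_card hA.left_subset
  have hX := h.card_left_le hR hout hin
  have hAc := hA.card_left
  have hBc := hA.card_right
  have hdeg : ∀ b ∈ B', Fintype.card V ≤ 4 * #(outN R b ∩ (X \ A)) + 8 * e + 4 * q := by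
    intro b hb
    have h1 := h.symm.card_outN_le (hA.right_subset (hB' hb))
    have h2 : outN R b ∩ X ⊆ (outN R b ∩ (X \ A)) ∪ (A \ inN R b) := by
      intro x hx
      simp only [mem_union, mem_inter, mem_sdiff, mem_outN, mem_inN] at hx ⊢
      have := hR _ _ hx.1
      tauto
    have h3 := (card_le_card h2).trans (card_union_le _ _)
    have := hmiss b hb
    have := hout b
    omega
  refine ⟨29 * q, B', by omega, by nlinarith, hB', ⟨hB'.trans hA.right_subset, sdiff_subset,
    by omega, ?_, by omega, fun b hb => ?_⟩, fun b hb => (hmiss b hb).trans (by omega)⟩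
  · obtain ⟨b, hb⟩ : B'.Nonempty := by rw [← card_pos]; omega
    have h1 := hdeg b hb
    have h2 := card_le_card (inter_subset_right : outN R b ∩ (X \ A) ⊆ X \ A)
    omega
  · have h1 := hdeg b hb
    have h2 := card_inter_add_card_sdiff (X \ A) (outN R b)
    rw [inter_comm] at h2
    omega

/-- The sets `U i` partition almost all vertices and `R` is close to the blow-up of a directed
`4`-cycle with these classes. -/
structure Frame (R : V → V → Prop) (e : ℕ) (U : ZMod 4 → Finset V) : Prop where
  disjoint : ∀ i j, i ≠ j → Disjoint (U i) (U j)
  card_compl : #(univ.filter fun v => ∀ i, v ∉ U i) ≤ e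
  card_le : ∀ i, 4 * #(U i) ≤ Fintype.card V + e
  out_miss : ∀ i, ∀ u ∈ U i, #(U (i + 1) \ outN R u) ≤ e
  in_miss : ∀ i, ∀ u ∈ U (i + 1), #(U i \ inN R u) ≤ e

theorem forall_zmod_four {P : ZMod 4 → Prop} (h0 : P 0) (h1 : P 1) (h2 : P 2) (h3 : P 3) :
    ∀ i, P i := by
  intro i
  have : i = 0 ∨ i = 1 ∨ i = 2 ∨ i = 3 := by revert i; decide
  rcases this with rfl | rfl | rfl | rfl <;> assumption

theorem NearBipartite.exists_frame_of_quarterPair {C : ℕ} (hC : 1 ≤ C) : ∃ C₀ ≥ 1,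
    ∀ (V : Type) [Fintype V] (R : V → V → Prop) (e p : ℕ) (X Y A B : Finset V),
    NearBipartite R e X Y → (∀ u v, R u v → ¬ R v u) →
    (∀ v, Fintype.card V + 1 ≤ 4 * #(outN R v)) → (∀ v, Fintype.card V + 1 ≤ 4 * #(inN R v)) →
    1 ≤ p → e ≤ p → QuarterPair R p X Y A B → C₀ * p ≤ Fintype.card V →
    ∃ e' U, C * e' ≤ Fintype.card V ∧ Frame R e' U := by
  obtain ⟨K, hK⟩ : ∃ K : ℕ → ℕ, ∀ C, K C = 4 * (29 * C) ^ 2 := ⟨_, fun _ => rfl⟩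
  have hK1 : ∀ C, 1 ≤ C → 1 ≤ K C := fun C hC => by rw [hK]; nlinarith
  have c5 : 1 ≤ 10 * C := by omega
  have c4 := hK1 _ c5
  have c3 := hK1 _ c4
  have c2 := hK1 _ c3
  have c1 := hK1 _ c2
  have c0 := hK1 _ c1
  refine ⟨_, c0, fun V _ R e p X Y A B h hR hout hin hp hep hA hn => ?_⟩
  obtain ⟨p₁, U₁, hp₁, hn₁, hU₁, hA₁, -⟩ :=
    h.quarterPair_step hR hout hin c1 hp hep hA (by rwa [hK] at hn)
  obtain ⟨p₂, U₂, hp₂, hn₂, hU₂, hA₂, hm₂⟩ :=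
    h.symm.quarterPair_step hR hout hin c2 (by omega) (by omega) hA₁ (by rwa [hK] at hn₁)
  obtain ⟨p₃, U₃, hp₃, hn₃, hU₃, hA₃, hm₃⟩ :=
    h.quarterPair_step hR hout hin c3 (by omega) (by omega) hA₂ (by rwa [hK] at hn₂)
  obtain ⟨p₄, U₀, hp₄, hn₄, hU₀, hA₄, hm₄⟩ :=
    h.symm.quarterPair_step hR hout hin c4 (by omega) (by omega) hA₃ (by rwa [hK] at hn₃)
  obtain ⟨p₅, U₅, hp₅, hn₅, hU₅, hA₅, hm₅⟩ :=
    h.quarterPair_step hR hout hin c5 (by omega) (by omega) hA₄ (by rwa [hK] at hn₄)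
  have hX := h.card_left_le hR hout hin
  have hY := h.symm.card_left_le hR hout hin
  have d02 : Disjoint U₀ U₂ := disjoint_left.2 fun x hx => (mem_sdiff.1 (hU₀ hx)).2
  have d53 : Disjoint U₅ U₃ := disjoint_left.2 fun x hx => (mem_sdiff.1 (hU₅ hx)).2
  have d31 : Disjoint U₃ U₁ := disjoint_left.2 fun x hx => (mem_sdiff.1 (hU₃ hx)).2
  have dXY : ∀ S T, S ⊆ X → T ⊆ Y → Disjoint S T := fun S T hS hT =>
    disjoint_of_subset_left hS (disjoint_of_subset_right hT h.disjoint)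
  have s0 := hA₄.left_subset
  have s1 := hA₁.left_subset
  have s2 := hA₂.left_subset
  have s3 := hA₃.left_subset
  have s5 := hA₅.left_subset
  have k0 := hA₄.card_left
  have k1 := hA₁.card_left
  have k2 := hA₂.card_left
  have k3 := hA₃.card_left
  have k5 := hA₅.card_left
  have x02 := card_sdiff_add_card_eq_card (union_subset s0 s2)
  have y53 := card_sdiff_add_card_eq_card (union_subset s5 s3)
  have y31 := card_sdiff_add_card_eq_card (union_subset s3 s1)
  rw [card_union_of_disjoint d02] at x02
  rw [card_union_of_disjoint d53] at y53
  rw [card_union_of_disjoint d31] at y31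
  refine ⟨10 * p₅, ![U₀, U₅, U₂, U₃], by rw [← mul_assoc, mul_comm C]; exact hn₅,
    ?_, ?_, ?_, ?_, ?_⟩
  · have hsymm : ∀ i j : Fin 4, i < j →
        Disjoint ((![U₀, U₅, U₂, U₃] : Fin 4 → Finset V) i) (![U₀, U₅, U₂, U₃] j) := by
      intro i j hij
      fin_cases i <;> fin_cases j <;> first | exact absurd hij (by decide) | skip
      · exact dXY _ _ s0 s5
      · exact d02
      · exact dXY _ _ s0 s3
      · exact (dXY _ _ s2 s5).symm
      · exact d53
      · exact dXY _ _ s2 s3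
    intro (i : Fin 4) (j : Fin 4) hij
    rcases @lt_or_gt_of_ne (Fin 4) _ i j hij with hij | hij
    · exact hsymm _ _ hij
    · exact (hsymm _ _ hij).symm
  · refine (card_le_card (t := (X ∪ Y)ᶜ ∪ (X \ (U₀ ∪ U₂)) ∪ (Y \ (U₅ ∪ U₃))) ?_).trans ?_
    · intro v hv
      simp only [mem_filter, mem_univ, true_and] at hv
      have v0 : v ∉ U₀ := hv 0
      have v1 : v ∉ U₅ := hv 1
      have v2 : v ∉ U₂ := hv 2
      have v3 : v ∉ U₃ := hv 3
      simp only [mem_union, mem_compl, mem_sdiff]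
      tauto
    have h3 := card_union_le ((X ∪ Y)ᶜ ∪ (X \ (U₀ ∪ U₂))) (Y \ (U₅ ∪ U₃))
    have h4 := card_union_le (X ∪ Y)ᶜ (X \ (U₀ ∪ U₂))
    have h5 := h.card_compl
    omega
  · refine forall_zmod_four ?_ ?_ ?_ ?_
    · have := card_le_card hU₀
      have := hA₃.card_right_le
      change 4 * #U₀ ≤ _
      omega
    · have := card_le_card hU₅
      have := hA₄.card_right_le
      change 4 * #U₅ ≤ _
      omega
    · have := card_le_card hU₂
      have := hA₁.card_right_le
      change 4 * #U₂ ≤ _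
      omega
    · have := card_le_card hU₃
      have := hA₂.card_right_le
      change 4 * #U₃ ≤ _
      omega
  · refine forall_zmod_four (fun u hu => ?_) (fun u hu => ?_) (fun u hu => ?_) (fun u hu => ?_)
    · have := hA₄.miss u hu
      have := card_le_card (sdiff_subset_sdiff hU₅ (subset_refl (outN R u)))
      change #(U₅ \ outN R u) ≤ _
      omega
    · have := hA₅.miss u hu
      have := card_le_card (sdiff_subset_sdiff (show U₂ ⊆ X \ U₀ from fun x hx =>
        mem_sdiff.2 ⟨s2 hx, disjoint_right.1 d02 hx⟩) (subset_refl (outN R u)))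
      change #(U₂ \ outN R u) ≤ _
      omega
    · have := hA₂.miss u hu
      have := card_le_card (sdiff_subset_sdiff hU₃ (subset_refl (outN R u)))
      change #(U₃ \ outN R u) ≤ _
      omega
    · have := hA₃.miss u hu
      have := card_le_card (sdiff_subset_sdiff hU₀ (subset_refl (outN R u)))
      change #(U₀ \ outN R u) ≤ _
      omega
  · refine forall_zmod_four (fun u hu => ?_) (fun u hu => ?_) (fun u hu => ?_) (fun u hu => ?_)
    · have := hm₅ u hu
      change #(U₀ \ inN R u) ≤ _
      omega
    · have h1 := hm₂ u hu
      have h2 : U₅ \ inN R u ⊆ (U₁ \ inN R u) ∪ (Y \ (U₃ ∪ U₁)) := by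
        intro y hy
        simp only [mem_union, mem_sdiff] at hy ⊢
        have := s5 hy.1
        have := disjoint_left.1 d53 hy.1
        tauto
      have h3 := (card_le_card h2).trans (card_union_le _ _)
      change #(U₅ \ inN R u) ≤ _
      omega
    · have := hm₃ u hu
      change #(U₂ \ inN R u) ≤ _
      omega
    · have := hm₄ u hu
      change #(U₃ \ inN R u) ≤ _
      omega

/-- A path with `ℓ - 3` vertices and ends in the same class yields a `QuarterPair`, unless it can be
closed to an `ℓ`-cycle. -/
theorem NearBipartite.exists_quarterPair {e ℓ : ℕ} {X Y : Finset V} (h : NearBipartite R e X Y)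
    (hR : ∀ u v, R u v → ¬ R v u) (hout : ∀ v, Fintype.card V + 1 ≤ 4 * #(outN R v))
    (hin : ∀ v, Fintype.card V + 1 ≤ 4 * #(inN R v)) (hn : 4 * ℓ + 8 * e ≤ Fintype.card V)
    (hno : ¬ HasCycle R ℓ) {L : List V} {a b : V} (hL : Path R L a b) (hℓ : L.length + 3 = ℓ)
    (ha : a ∈ Y) (hb : b ∈ Y) : ∃ A B, QuarterPair R (32 * e + 4 * ℓ) X Y A B := by
  have hLc := L.toFinset_card_le
  have oa := h.symm.card_inN_le ha
  have ia := hin a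
  have ob := h.symm.card_outN_le hb
  have ib := hout b
  obtain ⟨z, hz, -, hzL⟩ := exists_mem_notMem (S := inN R a ∩ X) (Z := ∅) le_rfl
    (by rw [card_empty]; omega) (le_refl L.length)
  simp only [mem_inter, mem_inN] at hz
  set A := (outN R b ∩ X) \ insert z L.toFinset
  set T := (inN R z ∩ Y) \ L.toFinset
  have hAc : #(outN R b ∩ X) ≤ #A + #(insert z L.toFinset) :=
    card_le_card_sdiff_add_card
  have hzc := card_insert_le z L.toFinset
  have hTc : #(inN R z ∩ Y) ≤ #T + #L.toFinset := card_le_card_sdiff_add_card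
  have oz := h.card_inN_le hz.2
  have iz := hin z
  have hTY : T ⊆ Y := sdiff_subset.trans inter_subset_right
  have hYT := card_sdiff_add_card_eq_card hTY
  have hY := h.symm.card_left_le hR hout hin
  have hAX : A ⊆ X := sdiff_subset.trans inter_subset_right
  have hAT : ∀ x ∈ A, outN R x ∩ Y ⊆ Y \ T := by
    intro x hx y hy
    refine mem_sdiff.2 ⟨(mem_inter.1 hy).2, fun hyT => hno ?_⟩
    have hxX := hAX hx
    simp only [A, T, mem_sdiff, mem_inter, mem_outN, mem_inN, mem_insert, not_or,
      List.mem_toFinset] at hx hy hyT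
    have hyX : ∀ w ∈ X, w ≠ y := fun w hw hwy => disjoint_left.1 h.disjoint hw (hwy ▸ hy.2)
    have hp : Path R [x, y, z] x z := by
      refine ⟨?_, by simp [hy.1, hyT.1.1], rfl, rfl⟩
      simp [hyX x hxX, hx.2.1, (hyX z hz.2).symm]
    have := (hL.append hp (by simp [List.disjoint_right, hx.2.2, hyT.2, hzL]) hx.1.1).hasCycle hz.1
    simpa [hℓ] using this
  have hdeg : ∀ x ∈ A, Fintype.card V ≤ 4 * #(outN R x ∩ (Y \ T)) + 8 * e := by
    intro x hx
    have h1 := card_le_card (subset_inter inter_subset_left (hAT x hx))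
    have h2 := h.card_outN_le (hAX hx)
    have h3 := hout x
    omega
  refine ⟨A, Y \ T, hAX, sdiff_subset, by omega, ?_, by omega, fun x hx => ?_⟩
  · obtain ⟨x, hx⟩ : A.Nonempty := by rw [← card_pos]; omega
    have h1 := hdeg x hx
    have h2 := card_le_card (inter_subset_right : outN R x ∩ (Y \ T) ⊆ Y \ T)
    omega
  · have h1 := hdeg x hx
    have h2 := card_inter_add_card_sdiff (Y \ T) (outN R x)
    rw [inter_comm] at h2
    omega

end Frame

section Segments

variable {V : Type*} [Fintype V] {R : V → V → Prop} {U : ZMod 4 → Finset V} {e g ℓ : ℕ}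

/-- `v` has many inneighbours in `U i`. -/
def DenseIn (R : V → V → Prop) (U : ZMod 4 → Finset V) (g : ℕ) (v : V) (i : ZMod 4) : Prop :=
  g ≤ #(inN R v ∩ U i)

/-- `v` has many outneighbours in `U i`. -/
def DenseOut (R : V → V → Prop) (U : ZMod 4 → Finset V) (g : ℕ) (v : V) (i : ZMod 4) : Prop :=
  g ≤ #(outN R v ∩ U i)

/-- `L` lists the vertices of a directed path which can be entered from many vertices of `U s` and
left to many vertices of `U t`. -/
def Seg (R : V → V → Prop) (U : ZMod 4 → Finset V) (g : ℕ) (L : List V) (s t : ZMod 4) : Prop :=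
  ∃ a b, Path R L a b ∧ DenseIn R U g a s ∧ DenseOut R U g b t

theorem Frame.exists_connection (h : Frame R e U) (hU : ∀ i, g ≤ #(U i)) {L : List V} {a b c : V}
    (hL : Path R L a b) {s t : ZMod 4} (hb : DenseOut R U g b t) (hc : DenseIn R U g c s) {k : ℕ}
    (hk : 1 ≤ k) (hkt : t + k = s) {Z : Finset V} (hZ : #Z + L.length + (k + 1) + e ≤ g) :
    ∃ L' w, L'.length = k + 1 ∧ Path R (L ++ L') a w ∧ R w c ∧ ∀ x ∈ L', x ∉ Z := by
  set C : ℕ → Finset V := fun i => if i = 0 then {b} else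
    (if i = 1 then outN R b ∩ U t else if i = k + 1 then inN R c ∩ U s else U (t + (i - 1 : ℕ)))
    with hCdef
  have hsub : ∀ i, 1 ≤ i → C i ⊆ U (t + (i - 1 : ℕ)) := by
    intro i hi
    simp only [hCdef]
    split_ifs with h0 h1 h2
    · omega
    · subst h1; simp
    · subst h2; simp [hkt]
    · exact subset_rfl
  have hcard : ∀ i, 1 ≤ i → g ≤ #(C i) := by
    intro i hi
    simp only [hCdef]
    split_ifs with h0 h1 h2
    · omega
    · exact hb
    · exact hc
    · exact hU _
  have hC : ∀ i < k + 1, ∀ u ∈ C i, g - e ≤ #(outN R u ∩ C (i + 1)) := by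
    intro i hi u hu
    rcases Nat.eq_zero_or_pos i with rfl | hi0
    · have hub : u = b := by simpa [hCdef] using hu
      subst hub
      have h1 : outN R u ∩ C (0 + 1) = outN R u ∩ U t := by simp [hCdef]
      rw [h1]
      exact (Nat.sub_le _ _).trans hb
    · have h1 := h.out_miss _ u (hsub i hi0 hu)
      have h2 := hsub (i + 1) (by omega)
      have h3 : t + ((i - 1 : ℕ) : ZMod 4) + 1 = t + (i + 1 - 1 : ℕ) := by
        obtain ⟨j, rfl⟩ := Nat.exists_eq_add_of_lt hi0
        simp [add_assoc]
      rw [h3] at h1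
      have h4 := card_le_card (sdiff_subset_sdiff h2 (subset_refl (outN R u)))
      have h5 := card_inter_add_card_sdiff (C (i + 1)) (outN R u)
      have h6 := hcard (i + 1) (by omega)
      rw [inter_comm]
      omega
  obtain ⟨L', w, h1, h2, h3, h4⟩ := Path.extend hC hL (by simp [hCdef]) (Z := Z) (by omega)
  refine ⟨L', w, h1, h2, ?_, h4⟩
  have h5 : w ∈ inN R c ∩ U s := by simpa [hCdef, show k ≠ 0 by omega] using h3
  exact mem_inN.1 (mem_inter.1 h5).1

theorem Frame.seg_join (h : Frame R e U) (hU : ∀ i, g ≤ #(U i)) {L L' : List V} {s t s' t' : ZMod 4}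
    (hL : Seg R U g L s t) (hL' : Seg R U g L' s' t') (hd : List.Disjoint L L') {k : ℕ}
    (hk : 1 ≤ k) (hkt : t + k = s') {Z : Finset V}
    (hZ : #Z + L.length + L'.length + (k + 1) + e ≤ g) :
    ∃ M, M.length = k + 1 ∧ Seg R U g (L ++ M ++ L') s t' ∧ ∀ x ∈ M, x ∉ Z := by
  obtain ⟨a, b, hp, ha, hb⟩ := hL
  obtain ⟨a', b', hp', ha', hb'⟩ := hL'
  have h1 := card_union_le Z L'.toFinset
  have h2 := L'.toFinset_card_le
  obtain ⟨M, w, hM, hpM, hw, hMZ⟩ := h.exists_connection hU hp hb ha' hk hkt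
    (Z := Z ∪ L'.toFinset) (by omega)
  refine ⟨M, hM, ⟨a, b', hpM.append hp' ?_ hw, ha, hb'⟩, fun x hx => ?_⟩
  · refine List.disjoint_append_left.2 ⟨hd, fun x hx hx' => hMZ x hx ?_⟩
    exact mem_union_right _ (List.mem_toFinset.2 hx')
  · exact fun hxZ => hMZ x hx (mem_union_left _ hxZ)

theorem Frame.seg_hasCycle (h : Frame R e U) (hU : ∀ i, g ≤ #(U i)) {L : List V} {s t : ZMod 4}
    (hL : Seg R U g L s t) (hℓ : L.length + 2 ≤ ℓ) (ht : t + ℓ = s + L.length + 1)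
    (hg : ℓ + e ≤ g) : HasCycle R ℓ := by
  obtain ⟨a, b, hp, ha, hb⟩ := hL
  obtain ⟨k, rfl⟩ := Nat.exists_eq_add_of_le hℓ
  have hkt : t + (k + 1 : ℕ) = s := by
    push_cast at ht ⊢
    linear_combination ht
  obtain ⟨M, w, hM, hpM, hw, -⟩ := h.exists_connection hU hp hb ha (by omega) hkt (Z := ∅)
    (by simp; omega)
  have := hpM.hasCycle hw
  rw [List.length_append, hM] at this
  convert this using 1
  ring

/-- The situation in which a hypothetical counterexample is close to a blow-up of `C₄`. -/
structure Tight (R : V → V → Prop) (U : ZMod 4 → Finset V) (e g ℓ : ℕ) : Prop where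
  frame : Frame R e U
  asymm : ∀ u v, R u v → ¬ R v u
  le_out : ∀ v, Fintype.card V + 1 ≤ 4 * #(outN R v)
  le_in : ∀ v, Fintype.card V + 1 ≤ 4 * #(inN R v)
  not_hasCycle : ¬ HasCycle R ℓ
  le_length : 15 ≤ ℓ
  mod_length : ℓ % 4 = 3
  add_le : e + 2 * ℓ ≤ g
  le_card : 200 * g ≤ Fintype.card V

namespace Tight

theorem card_le_sum (h : Tight R U e g ℓ) (S : Finset V) :
    #S ≤ #(S ∩ U 0) + #(S ∩ U 1) + #(S ∩ U 2) + #(S ∩ U 3) + e := by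
  have h1 : S ⊆ (S ∩ U 0) ∪ (S ∩ U 1) ∪ (S ∩ U 2) ∪ (S ∩ U 3) ∪
      univ.filter fun v => ∀ i, v ∉ U i := by
    intro v hv
    by_cases hU : ∀ i, v ∉ U i
    · exact mem_union_right _ (by simpa using hU)
    · push Not at hU
      obtain ⟨i, hi⟩ := hU
      have : i = 0 ∨ i = 1 ∨ i = 2 ∨ i = 3 := by clear hi; revert i; decide
      rcases this with rfl | rfl | rfl | rfl <;> simp [hv, hi]
  refine (card_le_card h1).trans ?_
  refine (card_union_le _ _).trans (add_le_add ?_ h.frame.card_compl)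
  refine (card_union_le _ _).trans (add_le_add_left ?_ _)
  refine (card_union_le _ _).trans (add_le_add_left ?_ _)
  exact card_union_le _ _

theorem le_card_class (h : Tight R U e g ℓ) : ∀ i, 40 * g ≤ #(U i) := by
  have h1 := h.card_le_sum univ
  simp only [univ_inter, card_univ] at h1
  have h2 := h.frame.card_le
  have := h2 0
  have := h2 1
  have := h2 2
  have := h2 3
  have := h.le_card
  have := h.add_le
  have := h.le_length
  refine forall_zmod_four ?_ ?_ ?_ ?_ <;> omega

theorem exists_denseIn (h : Tight R U e g ℓ) (v : V) : ∃ i, DenseIn R U g v i := by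
  by_contra! hv
  simp only [DenseIn, not_le] at hv
  have := h.card_le_sum (inN R v)
  have := hv 0
  have := hv 1
  have := hv 2
  have := hv 3
  have := h.le_card
  have := h.add_le
  have := h.le_length
  have := h.le_in v
  omega

theorem exists_denseOut (h : Tight R U e g ℓ) (v : V) : ∃ i, DenseOut R U g v i := by
  by_contra! hv
  simp only [DenseOut, not_le] at hv
  have := h.card_le_sum (outN R v)
  have := hv 0
  have := hv 1
  have := hv 2
  have := hv 3
  have := h.le_card
  have := h.add_le
  have := h.le_length
  have := h.le_out v
  omega

theorem denseOut_of_mem (h : Tight R U e g ℓ) {u : V} {p : ZMod 4} (hu : u ∈ U p) :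
    DenseOut R U g u (p + 1) := by
  have h1 := h.frame.out_miss p u hu
  have h2 := card_inter_add_card_sdiff (U (p + 1)) (outN R u)
  have h3 := h.le_card_class (p + 1)
  have := h.add_le
  rw [DenseOut, inter_comm]
  omega

theorem denseIn_of_mem (h : Tight R U e g ℓ) {u : V} {p : ZMod 4} (hu : u ∈ U p) :
    DenseIn R U g u (p - 1) := by
  have h1 := h.frame.in_miss (p - 1) u (by simpa using hu)
  have h2 := card_inter_add_card_sdiff (U (p - 1)) (inN R u)
  have h3 := h.le_card_class (p - 1)
  have := h.add_le
  rw [DenseIn, inter_comm]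
  omega

theorem ne_of_rel (h : Tight R U e g ℓ) {u v : V} (huv : R u v) : u ≠ v := by
  rintro rfl
  exact h.asymm _ _ huv huv

theorem le_card_self (h : Tight R U e g ℓ) (i : ZMod 4) : g ≤ #(U i) := by
  have := h.le_card_class i
  omega

theorem cast_length (h : Tight R U e g ℓ) : (ℓ : ZMod 4) = 3 := by
  rw [← Nat.mod_add_div ℓ 4, h.mod_length]
  push_cast
  rw [show (4 : ZMod 4) = 0 from rfl]
  simp

theorem seg_ne (h : Tight R U e g ℓ) {L : List V} {s t : ZMod 4} (hL : Seg R U g L s t)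
    (hlen : L.length ≤ 13) : t ≠ s + L.length + 2 := by
  rintro rfl
  refine h.not_hasCycle (h.frame.seg_hasCycle h.le_card_self hL ?_ ?_ ?_)
  · have := h.le_length; omega
  · have h4 : (4 : ZMod 4) = 0 := rfl
    rw [h.cast_length]
    linear_combination h4
  · have := h.add_le; omega

theorem seg_join (h : Tight R U e g ℓ) {L L' : List V} {s t s' t' : ZMod 4}
    (hL : Seg R U g L s t) (hL' : Seg R U g L' s' t') (hd : List.Disjoint L L') {k : ℕ}
    (hk : 1 ≤ k) (hkt : t + k = s') {Z : Finset V}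
    (hZ : #Z + L.length + L'.length + (k + 1) ≤ 30) :
    ∃ M, M.length = k + 1 ∧ Seg R U g (L ++ M ++ L') s t' ∧ ∀ x ∈ M, x ∉ Z :=
  h.frame.seg_join h.le_card_self hL hL' hd hk hkt (by
    have := h.add_le
    have := h.le_length
    omega)

theorem exists_jump (s t : ZMod 4) : ∃ k : ℕ, 1 ≤ k ∧ k ≤ 4 ∧ t + k = s := by
  have h1 : ∀ d : ZMod 4, ∃ k : Fin 4, ((k + 1 : ℕ) : ZMod 4) = d := by decide
  obtain ⟨k, hk⟩ := h1 (s - t)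
  exact ⟨k + 1, by omega, by omega, by rw [hk]; ring⟩

theorem false_of_two_segs (h : Tight R U e g ℓ) {L L' : List V} {s t s' t' : ZMod 4}
    (hL : Seg R U g L s t) (hL' : Seg R U g L' s' t') (hd : List.Disjoint L L')
    (hlen : L.length ≤ 2) (hlen' : L'.length ≤ 2) (ht : t = s + L.length)
    (ht' : t' = s' + L'.length + 3) : False := by
  obtain ⟨k, hk, hk4, hkt⟩ := exists_jump s' t
  obtain ⟨M, hM, hS, -⟩ := h.seg_join hL hL' hd hk hkt (Z := ∅) (by simp; omega)
  refine h.seg_ne hS (by simp [hM]; omega) ?_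
  rw [ht', ← hkt, ht]
  simp only [List.length_append, hM]
  push_cast
  ring

theorem false_of_three_segs (h : Tight R U e g ℓ) {L L' L'' : List V} {s t s' t' s'' t'' : ZMod 4}
    (hL : Seg R U g L s t) (hL' : Seg R U g L' s' t') (hL'' : Seg R U g L'' s'' t'')
    (hd : List.Disjoint L L') (hd' : List.Disjoint L L'') (hd'' : List.Disjoint L' L'') {k k' : ℕ}
    (hk : 1 ≤ k) (hk' : 1 ≤ k') (hkt : t + k = s') (hkt' : t' + k' = s'')
    (hlen : L.length + L'.length + L''.length + k + k' ≤ 11) (ht : t = s + L.length)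
    (ht' : t' = s' + L'.length) (ht'' : t'' = s'' + L''.length) : False := by
  have h1 := L''.toFinset_card_le
  obtain ⟨M, hM, hS, hZ⟩ := h.seg_join hL hL' hd hk hkt (Z := L''.toFinset) (by omega)
  obtain ⟨M', hM', hS', -⟩ := h.seg_join hS hL'' (by
    refine List.disjoint_append_left.2 ⟨List.disjoint_append_left.2 ⟨hd', fun x hx hx' => ?_⟩, hd''⟩
    exact hZ x hx (List.mem_toFinset.2 hx')) hk' hkt' (Z := ∅) (by simp [hM]; omega)
  refine h.seg_ne hS' (by simp [hM, hM']; omega) ?_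
  rw [ht'', ← hkt', ht', ← hkt, ht]
  simp only [List.length_append, hM, hM']
  push_cast
  have h4 : (4 : ZMod 4) = 0 := rfl
  linear_combination -h4

end Tight

end Segments

section Tight

variable {V : Type*} [Fintype V] {R : V → V → Prop} {U : ZMod 4 → Finset V} {e g ℓ : ℕ}

/-- The vertices through which a path can skip from `U i` to `U (i + 1)` in two steps. -/
noncomputable def passing (R : V → V → Prop) (U : ZMod 4 → Finset V) (g : ℕ) :
    Finset V :=
  univ.filter fun v => ∃ i, DenseIn R U g v i ∧ DenseOut R U g v (i + 1)

/-- The vertices which are joined to the classes of the frame like those of `U p ∪ U (p + 2)`. -/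
noncomputable def sameSide (R : V → V → Prop) (U : ZMod 4 → Finset V) (g : ℕ)
    (p : ZMod 4) : Finset V :=
  univ.filter fun v => v ∉ passing R U g ∧ (DenseIn R U g v (p - 1) ∨ DenseIn R U g v (p + 1))

/-- The vertices of `U p` which are joined to some other vertex of the same kind. -/
noncomputable def bad (R : V → V → Prop) (U : ZMod 4 → Finset V) (g : ℕ)
    (p : ZMod 4) : Finset V :=
  (U p \ passing R U g).filter fun u => ∃ x ∈ sameSide R U g p, x ∈ nbrs R u

/-- The vertices of `U p` all of whose neighbours are in the expected part of the graph. -/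
noncomputable def good (R : V → V → Prop) (U : ZMod 4 → Finset V) (g : ℕ)
    (p : ZMod 4) : Finset V :=
  (U p \ passing R U g) \ bad R U g p

theorem Seg.single {v : V} {i j : ZMod 4} (hi : DenseIn R U g v i)
    (hj : DenseOut R U g v j) : Seg R U g [v] i j :=
  ⟨v, v, Path.singleton v, hi, hj⟩

namespace Tight

theorem seg_pair (h : Tight R U e g ℓ) {u v : V} {i j : ZMod 4} (huv : R u v)
    (hi : DenseIn R U g u i) (hj : DenseOut R U g v j) : Seg R U g [u, v] i j :=
  ⟨u, v, Path.pair huv (h.ne_of_rel huv), hi, hj⟩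

theorem single_ne (h : Tight R U e g ℓ) {v : V} {i j : ZMod 4} (hi : DenseIn R U g v i)
    (hj : DenseOut R U g v j) : j ≠ i - 1 := by
  have h4 : (4 : ZMod 4) = 0 := rfl
  rintro rfl
  refine h.seg_ne (Seg.single hi hj) (by simp) ?_
  simp only [List.length_singleton]
  push_cast
  linear_combination -h4

theorem pair_ne (h : Tight R U e g ℓ) {u v : V} {i j : ZMod 4} (huv : R u v)
    (hi : DenseIn R U g u i) (hj : DenseOut R U g v j) : j ≠ i := by
  have h4 : (4 : ZMod 4) = 0 := rfl
  rintro rfl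
  refine h.seg_ne (h.seg_pair huv hi hj) (by simp) ?_
  simp only [List.length_cons, List.length_nil]
  push_cast
  linear_combination -h4

theorem card_passing_le (h : Tight R U e g ℓ) : #(passing R U g) ≤ 2 := by
  by_contra! hM
  obtain ⟨a, ha, b, hb, c, hc, hab, hac, hbc⟩ := two_lt_card.1 hM
  simp only [passing, mem_filter, mem_univ, true_and] at ha hb hc
  obtain ⟨i, ha⟩ := ha
  obtain ⟨j, hb⟩ := hb
  obtain ⟨k, hc⟩ := hc
  obtain ⟨x, hx, hx4, hxe⟩ := exists_jump j (i + 1)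
  obtain ⟨y, hy, hy4, hye⟩ := exists_jump k (j + 1)
  exact h.false_of_three_segs (Seg.single ha.1 ha.2) (Seg.single hb.1 hb.2) (Seg.single hc.1 hc.2)
    (by simpa using hab.symm) (by simpa using hac.symm) (by simpa using hbc.symm) hx hy hxe hye
    (by simp; omega) (by simp) (by simp) (by simp)

theorem single_ne_of_passing (h : Tight R U e g ℓ) {v x : V} (hv : v ∈ passing R U g) (hx : x ≠ v)
    {i j : ZMod 4} (hi : DenseIn R U g x i) (hj : DenseOut R U g x j) : j ≠ i := by
  have h4 : (4 : ZMod 4) = 0 := rfl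
  rintro rfl
  simp only [passing, mem_filter, mem_univ, true_and] at hv
  obtain ⟨k, hk⟩ := hv
  refine h.false_of_two_segs (Seg.single hk.1 hk.2) (Seg.single hi hj) (by simpa using hx)
    (by simp) (by simp) (by simp) ?_
  simp only [List.length_singleton]
  push_cast
  linear_combination -h4

theorem pair_ne_of_passing (h : Tight R U e g ℓ) {v x y : V} (hv : v ∈ passing R U g)
    (hx : x ≠ v) (hy : y ≠ v) (hxy : R x y) {i j : ZMod 4} (hi : DenseIn R U g x i)
    (hj : DenseOut R U g y j) : j ≠ i + 1 := by
  have h4 : (4 : ZMod 4) = 0 := rfl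
  rintro rfl
  simp only [passing, mem_filter, mem_univ, true_and] at hv
  obtain ⟨k, hk⟩ := hv
  refine h.false_of_two_segs (Seg.single hk.1 hk.2) (h.seg_pair hxy hi hj)
    (by simpa using ⟨hx.symm, hy.symm⟩) (by simp) (by simp) (by simp) ?_
  simp only [List.length_cons, List.length_nil]
  push_cast
  linear_combination -h4

/-- No vertex is joined densely to all four classes. -/
theorem exists_sparse (h : Tight R U e g ℓ) (v : V) :
    ∃ p, ¬ (DenseIn R U g v p ∨ DenseOut R U g v p) := by
  by_contra! hv
  obtain ⟨i, hi⟩ := h.exists_denseIn v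
  obtain ⟨j, hj⟩ := h.exists_denseOut v
  have hstep : ∀ i, DenseIn R U g v i → DenseIn R U g v (i - 1) := fun i hi =>
    (hv (i - 1)).resolve_right fun hO => h.single_ne hi hO rfl
  have hall : ∀ k : ℕ, DenseIn R U g v (i - k) := by
    intro k
    induction k with
    | zero => simpa using hi
    | succ k ih =>
      have := hstep _ ih
      rwa [sub_sub, ← Nat.cast_add_one] at this
  obtain ⟨k, -, -, hk⟩ := exists_jump i (j + 1)
  have := hall k
  rw [← hk] at this
  exact h.single_ne this hj (by ring)

theorem mem_sameSide {v : V} {p : ZMod 4} : v ∈ sameSide R U g p ↔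
    v ∉ passing R U g ∧ (DenseIn R U g v (p - 1) ∨ DenseIn R U g v (p + 1)) := by
  simp [sameSide]

theorem eq_or_of_notMem_passing (h : Tight R U e g ℓ) {v : V} (hv : v ∉ passing R U g)
    {i j : ZMod 4} (hi : DenseIn R U g v i) (hj : DenseOut R U g v j) : j = i ∨ j = i + 2 := by
  have h1 := h.single_ne hi hj
  have h2 : j ≠ i + 1 := by
    rintro rfl
    exact hv (by simpa [passing] using ⟨i, hi, hj⟩)
  clear hi hj
  revert i j
  decide

theorem eq_or_of_mem_sameSide (h : Tight R U e g ℓ) {v : V} {p j : ZMod 4}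
    (hv : v ∈ sameSide R U g p)
    (hj : DenseIn R U g v j ∨ DenseOut R U g v j) : j = p - 1 ∨ j = p + 1 := by
  rw [mem_sameSide] at hv
  obtain ⟨hM, hv⟩ := hv
  obtain ⟨i, hi, hip⟩ : ∃ i, DenseIn R U g v i ∧ (i = p - 1 ∨ i = p + 1) := by
    rcases hv with hv | hv
    exacts [⟨_, hv, .inl rfl⟩, ⟨_, hv, .inr rfl⟩]
  have hO : ∀ j, DenseOut R U g v j → j = p - 1 ∨ j = p + 1 := by
    intro j hj
    have := h.eq_or_of_notMem_passing hM hi hj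
    clear hv hi hj
    revert p i j
    decide
  rcases hj with hj | hj
  · obtain ⟨k, hk⟩ := h.exists_denseOut v
    have h1 := h.eq_or_of_notMem_passing hM hj hk
    have h2 := hO k hk
    clear hv hi hip hj hk hO
    revert p j k
    decide
  · exact hO j hj

theorem mem_sameSide_of_mem (h : Tight R U e g ℓ) {u : V} {p : ZMod 4} (hu : u ∈ U p)
    (hM : u ∉ passing R U g) : u ∈ sameSide R U g p :=
  mem_sameSide.2 ⟨hM, .inl (h.denseIn_of_mem hu)⟩

theorem mem_sameSide_or (h : Tight R U e g ℓ) {v : V} (p : ZMod 4) (hM : v ∉ passing R U g) :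
    v ∈ sameSide R U g p ∨ v ∈ sameSide R U g (p + 1) := by
  obtain ⟨i, hi⟩ := h.exists_denseIn v
  have : i = p - 1 ∨ i = p + 1 ∨ i = p + 1 - 1 ∨ i = p + 1 + 1 := by
    clear hi
    revert p i
    decide
  rcases this with rfl | rfl | rfl | rfl <;> rw [mem_sameSide, mem_sameSide] <;> tauto

theorem disjoint_sameSide (h : Tight R U e g ℓ) (p : ZMod 4) :
    Disjoint (sameSide R U g p) (sameSide R U g (p + 1)) := by
  refine disjoint_left.2 fun v hv hv' => ?_
  obtain ⟨i, hi⟩ := h.exists_denseIn v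
  have h1 := h.eq_or_of_mem_sameSide hv (.inl hi)
  have h2 := h.eq_or_of_mem_sameSide hv' (.inl hi)
  clear hi hv hv'
  revert p i
  decide

theorem sameSide_add_two (p : ZMod 4) : sameSide R U g (p + 1 + 1) = sameSide R U g p := by
  have h4 : (4 : ZMod 4) = 0 := rfl
  ext v
  rw [mem_sameSide, mem_sameSide, show p + 1 + 1 - 1 = p + 1 by ring,
    show p + 1 + 1 + 1 = p - 1 by linear_combination h4, or_comm (a := DenseIn _ _ _ _ (p + 1))]

theorem card_nbrs_inter_lt (h : Tight R U e g ℓ) {v : V} {p : ZMod 4} (hv : v ∈ sameSide R U g p) :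
    #(nbrs R v ∩ U p) ≤ 2 * g := by
  have h1 : ¬ (DenseIn R U g v p ∨ DenseOut R U g v p) := fun hj => by
    have := h.eq_or_of_mem_sameSide hv hj
    clear hj hv
    revert p
    decide
  simp only [DenseIn, DenseOut, not_or, not_le] at h1
  have h2 : nbrs R v ∩ U p ⊆ (inN R v ∩ U p) ∪ (outN R v ∩ U p) := by
    intro w hw
    simp only [mem_inter, mem_nbrs, mem_union, mem_inN, mem_outN] at hw ⊢
    tauto
  have h3 := (card_le_card h2).trans (card_union_le _ _)
  omega

theorem seg_of_nbrs (h : Tight R U e g ℓ) {u x : V} {p : ZMod 4} (hu : u ∈ U p)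
    (hx : x ∈ sameSide R U g p) (hux : x ∈ nbrs R u) :
    ∃ L, L.length = 2 ∧ Seg R U g L (p - 1) (p + 1) ∧ ∀ y ∈ L, y = u ∨ y = x := by
  rcases mem_nbrs.1 hux with hux | hux
  · refine ⟨[u, x], rfl, h.seg_pair hux (h.denseIn_of_mem hu) ?_, by simp⟩
    obtain ⟨j, hj⟩ := h.exists_denseOut x
    rcases h.eq_or_of_mem_sameSide hx (.inr hj) with rfl | rfl
    · exact absurd rfl (h.pair_ne hux (h.denseIn_of_mem hu) hj)
    · exact hj
  · refine ⟨[x, u], rfl, h.seg_pair hux ?_ (h.denseOut_of_mem hu), by simp [or_comm]⟩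
    obtain ⟨j, hj⟩ := h.exists_denseIn x
    rcases h.eq_or_of_mem_sameSide hx (.inl hj) with rfl | rfl
    · exact hj
    · exact absurd rfl (h.pair_ne hux hj (h.denseOut_of_mem hu))

theorem exists_seg_of_card_bad (h : Tight R U e g ℓ) {p : ZMod 4} (hbad : 9 * g < #(bad R U g p))
    {W : Finset V} (hW : W ⊆ sameSide R U g p) (hWc : #W ≤ 4) :
    ∃ L, L.length = 2 ∧ Seg R U g L (p - 1) (p + 1) ∧ (∀ y ∈ L, y ∉ W) ∧
      ∀ y ∈ L, y ∈ sameSide R U g p := by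
  have h1 : ∃ u ∈ bad R U g p, u ∉ W ∪ W.biUnion fun w => nbrs R w ∩ U p := by
    by_contra! hc
    have h2 := (card_le_card hc).trans (card_union_le _ _)
    have h3 := card_biUnion_le_card_mul W (fun w => nbrs R w ∩ U p) (2 * g)
      fun w hw => h.card_nbrs_inter_lt (hW hw)
    have h4 : #W * (2 * g) ≤ 4 * (2 * g) := by gcongr
    have := h.add_le
    have := h.le_length
    omega
  obtain ⟨u, hu, huW⟩ := h1
  simp only [bad, mem_filter, mem_sdiff] at hu
  obtain ⟨⟨hup, huM⟩, x, hx, hux⟩ := hu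
  obtain ⟨L, hL, hS, hLux⟩ := h.seg_of_nbrs hup hx hux
  simp only [mem_union, mem_biUnion, mem_inter, not_or, not_exists, not_and] at huW
  refine ⟨L, hL, hS, fun y hy => ?_, fun y hy => ?_⟩
  · rcases hLux y hy with rfl | rfl
    · exact huW.1
    · intro hyW
      refine huW.2 y hyW ?_ hup
      rw [mem_nbrs] at hux ⊢
      exact hux.symm
  · rcases hLux y hy with rfl | rfl
    · exact h.mem_sameSide_of_mem hup huM
    · exact hx

theorem card_bad_le (h : Tight R U e g ℓ) (p : ZMod 4) : #(bad R U g p) ≤ 9 * g := by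
  have h4 : (4 : ZMod 4) = 0 := rfl
  by_contra! hbad
  obtain ⟨L, hL, hS, -, hLi⟩ := h.exists_seg_of_card_bad hbad (W := ∅) (by simp) (by simp)
  have hLc := L.toFinset_card_le
  obtain ⟨L', hL', hS', hd', hLi'⟩ := h.exists_seg_of_card_bad hbad (W := L.toFinset)
    (fun x hx => hLi x (List.mem_toFinset.1 hx)) (by omega)
  have hLc' := L'.toFinset_card_le
  have hcu := card_union_le L.toFinset L'.toFinset
  obtain ⟨L'', hL'', hS'', hd'', -⟩ := h.exists_seg_of_card_bad hbad
    (W := L.toFinset ∪ L'.toFinset) (by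
      intro x hx
      rcases mem_union.1 hx with hx | hx
      · exact hLi x (List.mem_toFinset.1 hx)
      · exact hLi' x (List.mem_toFinset.1 hx)) (by omega)
  simp only [mem_union, List.mem_toFinset, not_or] at hd' hd''
  have hk : p + 1 + (2 : ℕ) = p - 1 := by push_cast; linear_combination h4
  refine h.false_of_three_segs hS hS' hS'' (fun x hx hx' => hd' x hx' hx)
    (fun x hx hx' => (hd'' x hx').1 hx) (fun x hx hx' => (hd'' x hx').2 hx) one_le_two one_le_two
    hk hk (by omega) ?_ ?_ ?_
  · rw [hL]; push_cast; ring
  · rw [hL']; push_cast; ring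
  · rw [hL'']; push_cast; ring

theorem le_card_good (h : Tight R U e g ℓ) (p : ZMod 4) : 4 * g < #(good R U g p) := by
  have h1 := h.le_card_class p
  have h2 := h.card_passing_le
  have h3 := h.card_bad_le p
  have h4 := le_card_sdiff (passing R U g) (U p)
  have h5 := le_card_sdiff (bad R U g p) (U p \ passing R U g)
  have := h.add_le
  have := h.le_length
  rw [good]
  omega

theorem good_subset (p : ZMod 4) : good R U g p ⊆ U p := sdiff_subset.trans sdiff_subset

theorem notMem_passing_of_mem_good {u : V} {p : ZMod 4} (hu : u ∈ good R U g p) :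
    u ∉ passing R U g := by
  simp only [good, mem_sdiff] at hu
  exact hu.1.2

theorem notMem_sameSide_of_mem_good {u x : V} {p : ZMod 4} (hu : u ∈ good R U g p)
    (hx : x ∈ nbrs R u) : x ∉ sameSide R U g p := by
  simp only [good, bad, mem_sdiff, mem_filter, not_and, not_exists] at hu
  exact fun hxp => hu.2 hu.1 x hxp hx

theorem card_passing_lt (h : Tight R U e g ℓ) {p : ZMod 4} {u u' : V} (hu : u ∈ good R U g p)
    (hu' : u' ∈ good R U g (p + 1)) :
    #(passing R U g) < #(nbrs R u ∩ passing R U g) + #(nbrs R u' ∩ passing R U g) := by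
  have hsub : ∀ q u, u ∈ good R U g q →
      Fintype.card V + 1 ≤ 2 * (#(sameSide R U g (q + 1)) + #(nbrs R u ∩ passing R U g)) := by
    intro q u hu
    have h1 : nbrs R u ⊆ sameSide R U g (q + 1) ∪ (nbrs R u ∩ passing R U g) := by
      intro x hx
      by_cases hM : x ∈ passing R U g
      · exact mem_union_right _ (mem_inter.2 ⟨hx, hM⟩)
      · exact mem_union_left _ ((h.mem_sameSide_or q hM).resolve_left
          (notMem_sameSide_of_mem_good hu hx))
    have h2 := (card_le_card h1).trans (card_union_le _ _)
    have h3 := card_nbrs h.asymm u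
    have := h.le_out u
    have := h.le_in u
    omega
  have h1 := hsub p u hu
  have h2 := hsub _ u' hu'
  rw [sameSide_add_two] at h2
  have h3 : #(sameSide R U g p) + #(sameSide R U g (p + 1)) + #(passing R U g) ≤
      Fintype.card V := by
    rw [← card_union_of_disjoint (h.disjoint_sameSide p), ← card_union_of_disjoint]
    · exact card_le_univ _
    · refine disjoint_left.2 fun x hx hM => ?_
      simp only [mem_union, mem_sameSide] at hx
      tauto
  omega

/-- A vertex joined to half of a set of good vertices is joined densely to the class. -/
theorem dense_of_forall_good (h : Tight R U e g ℓ) {p : ZMod 4} {v w : V}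
    (hvw : ∀ u ∈ good R U g p, u ∈ nbrs R v ∨ u ∈ nbrs R w) :
    (DenseIn R U g v p ∨ DenseOut R U g v p) ∨ DenseIn R U g w p ∨ DenseOut R U g w p := by
  by_contra! hc
  simp only [DenseIn, DenseOut, not_le] at hc
  have h1 : good R U g p ⊆ ((inN R v ∩ U p) ∪ (outN R v ∩ U p)) ∪
      ((inN R w ∩ U p) ∪ (outN R w ∩ U p)) := by
    intro u hu
    have h2 := good_subset p hu
    have h3 := hvw u hu
    simp only [mem_union, mem_inter, mem_nbrs, mem_inN, mem_outN] at h3 ⊢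
    tauto
  have h2 := (card_le_card h1).trans (card_union_le _ _)
  have h3 := card_union_le (inN R v ∩ U p) (outN R v ∩ U p)
  have h4 := card_union_le (inN R w ∩ U p) (outN R w ∩ U p)
  have := h.le_card_good p
  omega

end Tight

end Tight

section Tight

variable {V : Type*} [Fintype V] {R : V → V → Prop} {U : ZMod 4 → Finset V} {e g ℓ : ℕ}

/-- The vertices outside `passing R U g` which are joined to the classes like those of `U p`. -/
noncomputable def alike (R : V → V → Prop) (U : ZMod 4 → Finset V) (g : ℕ) (p : ZMod 4) :
    Finset V :=
  univ.filter fun v => v ∉ passing R U g ∧ DenseIn R U g v (p - 1) ∧ DenseOut R U g v (p + 1)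

theorem mem_alike {v : V} {p : ZMod 4} : v ∈ alike R U g p ↔
    v ∉ passing R U g ∧ DenseIn R U g v (p - 1) ∧ DenseOut R U g v (p + 1) := by
  simp [alike]

namespace Tight

theorem eq_add_two (h : Tight R U e g ℓ) {v x : V} (hv : v ∈ passing R U g)
    (hx : x ∉ passing R U g) {i j : ZMod 4} (hi : DenseIn R U g x i) (hj : DenseOut R U g x j) :
    j = i + 2 :=
  (h.eq_or_of_notMem_passing hx hi hj).resolve_left
    (h.single_ne_of_passing hv (ne_of_mem_of_not_mem hv hx).symm hi hj)

theorem exists_mem_alike (h : Tight R U e g ℓ) {v x : V} (hv : v ∈ passing R U g)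
    (hx : x ∉ passing R U g) : ∃ p, x ∈ alike R U g p := by
  obtain ⟨i, hi⟩ := h.exists_denseIn x
  obtain ⟨j, hj⟩ := h.exists_denseOut x
  obtain rfl := h.eq_add_two hv hx hi hj
  exact ⟨i + 1, mem_alike.2 ⟨hx, by simpa using hi, by rwa [add_assoc, one_add_one_eq_two]⟩⟩

theorem disjoint_alike (h : Tight R U e g ℓ) {v : V} (hv : v ∈ passing R U g) {p q : ZMod 4}
    (hpq : p ≠ q) : Disjoint (alike R U g p) (alike R U g q) := by
  refine disjoint_left.2 fun x hx hx' => hpq ?_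
  rw [mem_alike] at hx hx'
  linear_combination -h.eq_add_two hv hx.1 hx.2.1 hx'.2.2

theorem outN_subset_of_mem_good (h : Tight R U e g ℓ) {v u : V} (hv : v ∈ passing R U g)
    {p : ZMod 4} (hu : u ∈ good R U g p) :
    outN R u ⊆ alike R U g (p + 1) ∪ passing R U g := by
  intro x hx
  by_cases hM : x ∈ passing R U g
  · exact mem_union_right _ hM
  refine mem_union_left _ ?_
  obtain ⟨r, hr⟩ := h.exists_mem_alike hv hM
  have hr' := mem_alike.1 hr
  have huM := notMem_passing_of_mem_good hu
  have hui := h.denseIn_of_mem (good_subset p hu)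
  have h1 := h.pair_ne (mem_outN.1 hx) hui hr'.2.2
  have h2 := h.pair_ne_of_passing hv (ne_of_mem_of_not_mem hv huM).symm
    (ne_of_mem_of_not_mem hv hM).symm
    (mem_outN.1 hx) hui hr'.2.2
  have h3 := notMem_sameSide_of_mem_good hu (mem_nbrs.2 (.inl (mem_outN.1 hx)))
  rw [mem_sameSide] at h3
  have h4 : r - 1 ≠ p - 1 := fun h4 => h3 ⟨hM, .inl (h4 ▸ hr'.2.1)⟩
  have h5 : r - 1 ≠ p + 1 := fun h5 => h3 ⟨hM, .inr (h5 ▸ hr'.2.1)⟩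
  suffices r = p + 1 by rwa [this] at hr
  clear hr hr' hui h3 hu
  revert p r
  decide

theorem inN_subset_of_mem_good (h : Tight R U e g ℓ) {v u : V} (hv : v ∈ passing R U g)
    {p : ZMod 4} (hu : u ∈ good R U g p) :
    inN R u ⊆ alike R U g (p - 1) ∪ passing R U g := by
  intro x hx
  by_cases hM : x ∈ passing R U g
  · exact mem_union_right _ hM
  refine mem_union_left _ ?_
  obtain ⟨r, hr⟩ := h.exists_mem_alike hv hM
  have hr' := mem_alike.1 hr
  have huM := notMem_passing_of_mem_good hu
  have hui := h.denseOut_of_mem (good_subset p hu)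
  have h1 := h.pair_ne (mem_inN.1 hx) hr'.2.1 hui
  have h2 := h.pair_ne_of_passing hv (ne_of_mem_of_not_mem hv hM).symm
    (ne_of_mem_of_not_mem hv huM).symm
    (mem_inN.1 hx) hr'.2.1 hui
  have h3 := notMem_sameSide_of_mem_good hu (mem_nbrs.2 (.inr (mem_inN.1 hx)))
  rw [mem_sameSide] at h3
  have h4 : r - 1 ≠ p - 1 := fun h4 => h3 ⟨hM, .inl (h4 ▸ hr'.2.1)⟩
  have h5 : r - 1 ≠ p + 1 := fun h5 => h3 ⟨hM, .inr (h5 ▸ hr'.2.1)⟩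
  suffices r = p - 1 by rwa [this] at hr
  clear hr hr' hui h3 hu
  revert p r
  decide

theorem exists_mem_good (h : Tight R U e g ℓ) (p : ZMod 4) : ∃ u, u ∈ good R U g p := by
  have := h.le_card_good p
  exact card_pos.1 (by omega)

theorem false_of_card_alike_le (h : Tight R U e g ℓ) {v w : V} (hvw : v ≠ w)
    (hM : passing R U g = {v, w}) {q : ZMod 4} (hvo : DenseOut R U g v (q + 2))
    (hwi : DenseIn R U g w (q + 2)) (hq : 4 * #(alike R U g q) ≤ Fintype.card V) : False := by
  have h4 : (4 : ZMod 4) = 0 := rfl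
  have hwM : w ∈ passing R U g := by simp [hM]
  have hvM : v ∈ passing R U g := by simp [hM]
  have hvU : ∀ y ∈ good R U g (q + 1), R v y := by
    intro y hy
    by_contra hvy
    have hsub : inN R y ⊆ alike R U g q := by
      intro x hx
      have h1 := h.inN_subset_of_mem_good hvM hy hx
      rw [mem_inN] at hx
      simp only [add_sub_cancel_right, hM, mem_union, mem_insert, mem_singleton] at h1
      rcases h1 with h1 | rfl | rfl
      · exact h1
      · exact absurd hx hvy
      · exact absurd (by ring) (h.pair_ne hx hwi (h.denseOut_of_mem (good_subset _ hy)))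
    have := card_le_card hsub
    have := h.le_in y
    omega
  have hvo' : DenseOut R U g v (q + 1) := by
    have h1 := card_le_card (show good R U g (q + 1) ⊆ outN R v ∩ U (q + 1) from fun y hy =>
      mem_inter.2 ⟨mem_outN.2 (hvU y hy), good_subset _ hy⟩)
    have := h.le_card_good (q + 1)
    rw [DenseOut]
    omega
  by_cases hwv : R w v
  · exact h.pair_ne hwv hwi hvo rfl
  have hsub : inN R v ⊆ alike R U g q := by
    intro z hz
    rw [mem_inN] at hz
    by_cases hzM : z ∈ passing R U g
    · rw [hM, mem_insert, mem_singleton] at hzM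
      rcases hzM with rfl | rfl
      · exact absurd rfl (h.ne_of_rel hz)
      · exact absurd hz hwv
    obtain ⟨r, hr⟩ := h.exists_mem_alike hvM hzM
    have hri := (mem_alike.1 hr).2.1
    have hzw : z ≠ w := (ne_of_mem_of_not_mem hwM hzM).symm
    have h1 := h.pair_ne hz hri hvo
    have h2 := h.pair_ne_of_passing hwM hzw hvw hz hri hvo
    have h3 := h.pair_ne_of_passing hwM hzw hvw hz hri hvo'
    suffices r = q by rwa [this] at hr
    clear hvo hvo' hwi hq hvU hr hri
    revert q r
    decide
  have := card_le_card hsub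
  have := h.le_in v
  omega

/-- The two passing vertices cannot be attached to the frame in opposite ways. -/
theorem false_of_opposite (h : Tight R U e g ℓ) {v w : V} (hvw : v ≠ w)
    (hM : passing R U g = {v, w}) {q : ZMod 4} (hvi : DenseIn R U g v q)
    (hvo : DenseOut R U g v (q + 2)) (hwi : DenseIn R U g w (q + 2)) (hwo : DenseOut R U g w q) :
    False := by
  have h4 : (4 : ZMod 4) = 0 := rfl
  have hwM : w ∈ passing R U g := by simp [hM]
  have hvM : v ∈ passing R U g := by simp [hM]
  obtain ⟨u, hu⟩ := h.exists_mem_good q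
  have huM := notMem_passing_of_mem_good hu
  have huU := good_subset q hu
  have huv : u ≠ v := (ne_of_mem_of_not_mem hvM huM).symm
  have huw : u ≠ w := (ne_of_mem_of_not_mem hwM huM).symm
  have hout : outN R u ⊆ insert v (alike R U g (q + 1)) := by
    intro x hx
    have h1 := h.outN_subset_of_mem_good hvM hu hx
    rw [mem_outN] at hx
    simp only [hM, mem_union, mem_insert, mem_singleton] at h1 ⊢
    rcases h1 with h1 | rfl | rfl
    · exact .inr h1
    · exact .inl rfl
    · exact absurd (by ring) (h.pair_ne_of_passing hvM huv hvw.symm hx (h.denseIn_of_mem huU) hwo)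
  have hin : inN R u ⊆ insert w (alike R U g (q - 1)) := by
    intro x hx
    have h1 := h.inN_subset_of_mem_good hvM hu hx
    rw [mem_inN] at hx
    simp only [hM, mem_union, mem_insert, mem_singleton] at h1 ⊢
    rcases h1 with h1 | rfl | rfl
    · exact .inr h1
    · exact absurd rfl (h.pair_ne_of_passing hwM hvw huw hx hvi (h.denseOut_of_mem huU))
    · exact .inl rfl
  have c1 := (card_le_card hout).trans (card_insert_le _ _)
  have c2 := (card_le_card hin).trans (card_insert_le _ _)
  have c3 := h.le_out u
  have c4 := h.le_in u
  have c5 : #(univ.biUnion (alike R U g)) + #(passing R U g) ≤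
      Fintype.card V := by
    rw [← card_union_of_disjoint]
    · exact card_le_univ _
    · refine disjoint_left.2 fun x hx hxM => ?_
      obtain ⟨r, -, hr⟩ := mem_biUnion.1 hx
      exact (mem_alike.1 hr).1 hxM
  rw [card_biUnion fun p _ r _ hpr => h.disjoint_alike hvM hpr, hM, card_pair hvw] at c5
  have c6 : ∑ p, #(alike R U g p) = #(alike R U g q) + #(alike R U g (q + 1)) +
      #(alike R U g (q + 2)) + #(alike R U g (q - 1)) := by
    rw [← Equiv.sum_comp (Equiv.addLeft q)]
    have h5 : q + 3 = q - 1 := by linear_combination h4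
    rw [← h5]
    change ∑ i : Fin 4, #(alike R U g (q + (id i : ZMod 4))) = _
    rw [Fin.sum_univ_four]
    change #(alike R U g (q + 0)) + _ + _ + _ = _
    rw [add_zero]
    rfl
  have h6 : q + 2 + 2 = q := by linear_combination h4
  by_cases hq : 4 * #(alike R U g q) ≤ Fintype.card V
  · exact h.false_of_card_alike_le hvw hM hvo hwi hq
  · exact h.false_of_card_alike_le hvw.symm (by rw [hM, pair_comm]) (q := q + 2) (by rwa [h6])
      (by rwa [h6]) (by omega)

theorem denseIn_and_denseOut (h : Tight R U e g ℓ) {v w : V} (hwM : w ∈ passing R U g)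
    (hvw : v ≠ w) {p : ZMod 4} (h0 : DenseIn R U g v p ∨ DenseOut R U g v p)
    (h1 : DenseIn R U g v (p + 1) ∨ DenseOut R U g v (p + 1))
    (h2 : DenseIn R U g v (p + 2) ∨ DenseOut R U g v (p + 2))
    (h3 : ¬ (DenseIn R U g v (p + 3) ∨ DenseOut R U g v (p + 3))) :
    DenseIn R U g v p ∧ DenseOut R U g v (p + 2) := by
  have ha : ∀ i, DenseIn R U g v i → ¬ DenseOut R U g v i := fun i hi hj =>
    h.single_ne_of_passing hwM hvw hi hj rfl
  have hb : ∀ i, DenseIn R U g v (i + 1) → ¬ DenseOut R U g v i := fun i hi hj =>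
    h.single_ne hi hj (by ring)
  have hcase : ∀ P : ZMod 4 → Prop, (∃ i, P i) → P p ∨ P (p + 1) ∨ P (p + 2) ∨ P (p + 3) := by
    rintro P ⟨i, hi⟩
    have : i = p ∨ i = p + 1 ∨ i = p + 2 ∨ i = p + 3 := by
      clear h0 h1 h2 h3 hi
      revert p i
      decide
    rcases this with rfl | rfl | rfl | rfl
    exacts [.inl hi, .inr (.inl hi), .inr (.inr (.inl hi)), .inr (.inr (.inr hi))]
  have hb1 := hb (p + 1)
  rw [add_assoc, one_add_one_eq_two] at hb1
  rw [not_or] at h3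
  by_cases i0 : DenseIn R U g v p
  · refine ⟨i0, h2.resolve_left fun i2 => ?_⟩
    have i1 := h1.resolve_right (hb1 i2)
    rcases hcase _ (h.exists_denseOut v) with hO | hO | hO | hO
    exacts [ha _ i0 hO, ha _ i1 hO, ha _ i2 hO, h3.2 hO]
  · have o0 := h0.resolve_left i0
    have o1 := h1.resolve_left fun i1 => hb _ i1 o0
    rcases hcase _ (h.exists_denseIn v) with hI | hI | hI | hI
    exacts [absurd hI i0, absurd o0 (hb _ hI), absurd o1 (hb1 hI), absurd hI h3.1]

theorem false_of_dense (h : Tight R U e g ℓ) {v w : V} (hvw : v ≠ w)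
    (hM : passing R U g = {v, w}) {p : ZMod 4}
    (hv0 : DenseIn R U g v p ∨ DenseOut R U g v p)
    (hv2 : DenseIn R U g v (p + 2) ∨ DenseOut R U g v (p + 2))
    (hw0 : DenseIn R U g w p ∨ DenseOut R U g w p)
    (hw2 : DenseIn R U g w (p + 2) ∨ DenseOut R U g w (p + 2))
    (h1 : (DenseIn R U g v (p + 1) ∨ DenseOut R U g v (p + 1)) ∨
      DenseIn R U g w (p + 1) ∨ DenseOut R U g w (p + 1))
    (h3 : (DenseIn R U g v (p + 3) ∨ DenseOut R U g v (p + 3)) ∨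
      DenseIn R U g w (p + 3) ∨ DenseOut R U g w (p + 3)) : False := by
  have hwM : w ∈ passing R U g := by simp [hM]
  have hvM : v ∈ passing R U g := by simp [hM]
  have h4 : (4 : ZMod 4) = 0 := rfl
  have e2 : p + 2 + 2 = p := by linear_combination h4
  have e1 : p + 2 + 1 = p + 3 := by ring
  have e3 : p + 2 + 3 = p + 1 := by linear_combination h4
  have hsp : ∀ x, (DenseIn R U g x p ∨ DenseOut R U g x p) →
      (DenseIn R U g x (p + 2) ∨ DenseOut R U g x (p + 2)) →
      ¬ (DenseIn R U g x (p + 1) ∨ DenseOut R U g x (p + 1)) ∨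
      ¬ (DenseIn R U g x (p + 3) ∨ DenseOut R U g x (p + 3)) := by
    intro x h0 h2
    obtain ⟨i, hi⟩ := h.exists_sparse x
    have : i = p ∨ i = p + 1 ∨ i = p + 2 ∨ i = p + 3 := by
      clear hv0 hv2 hw0 hw2 h1 h3 h0 h2 hi e1 e2 e3
      revert p i
      decide
    rcases this with rfl | rfl | rfl | rfl
    exacts [absurd h0 hi, .inl hi, absurd h2 hi, .inr hi]
  have hvs := hsp v hv0 hv2
  have hws := hsp w hw0 hw2
  have key : ∀ x y, x ≠ y → passing R U g = {x, y} →
      (DenseIn R U g x p ∨ DenseOut R U g x p) →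
      (DenseIn R U g x (p + 2) ∨ DenseOut R U g x (p + 2)) →
      (DenseIn R U g y p ∨ DenseOut R U g y p) →
      (DenseIn R U g y (p + 2) ∨ DenseOut R U g y (p + 2)) →
      (DenseIn R U g x (p + 1) ∨ DenseOut R U g x (p + 1)) →
      ¬ (DenseIn R U g x (p + 3) ∨ DenseOut R U g x (p + 3)) →
      (DenseIn R U g y (p + 3) ∨ DenseOut R U g y (p + 3)) →
      ¬ (DenseIn R U g y (p + 1) ∨ DenseOut R U g y (p + 1)) → False := by
    intro x y hxy hM' x0 x2 y0 y2 x1 x3 y3 y1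
    obtain ⟨hxi, hxo⟩ := h.denseIn_and_denseOut (w := y) (by simp [hM']) hxy x0 x1 x2 x3
    obtain ⟨hyi, hyo⟩ := h.denseIn_and_denseOut (w := x) (p := p + 2) (by simp [hM']) hxy.symm y2
      (by rwa [e1]) (by rwa [e2]) (by rwa [e3])
    rw [e2] at hyo
    exact h.false_of_opposite hxy hM' hxi hxo hyi hyo
  by_cases hv3 : DenseIn R U g v (p + 3) ∨ DenseOut R U g v (p + 3)
  · have hv1 := hvs.resolve_right (not_not.2 hv3)
    have hw1 := h1.resolve_left hv1
    exact key w v hvw.symm (by rw [hM, pair_comm]) hw0 hw2 hv0 hv2 hw1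
      (hws.resolve_left (not_not.2 hw1)) hv3 hv1
  · have hw3 := h3.resolve_left hv3
    have hw1 := hws.resolve_right (not_not.2 hw3)
    exact key v w hvw hM hv0 hv2 hw0 hw2 (h1.resolve_right hw1) hv3 hw3 hw1

theorem elim (h : Tight R U e g ℓ) : False := by
  have h4 : (4 : ZMod 4) = 0 := rfl
  have hle := h.card_passing_le
  have hinter : ∀ u, #(nbrs R u ∩ passing R U g) ≤ #(passing R U g) := fun u =>
    card_le_card inter_subset_right
  have hone : ∀ p, ∀ u ∈ good R U g p, 1 ≤ #(nbrs R u ∩ passing R U g) := by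
    intro p u hu
    obtain ⟨u', hu'⟩ := h.exists_mem_good (p + 1)
    have := h.card_passing_lt hu hu'
    have := hinter u'
    omega
  by_cases hM : #(passing R U g) ≤ 1
  · obtain ⟨u, hu⟩ := h.exists_mem_good 0
    obtain ⟨v, hv⟩ := card_pos.1 (hone 0 u hu)
    have hv := (mem_inter.1 hv).2
    obtain ⟨p, hp⟩ := h.exists_sparse v
    refine hp (or_self_iff.1 (h.dense_of_forall_good fun u hu => or_self_iff.2 ?_))
    obtain ⟨w, hw⟩ := card_pos.1 (hone p u hu)
    rw [card_le_one.1 hM w (mem_of_mem_inter_right hw) v hv] at hw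
    exact mem_nbrs_comm.1 (mem_inter.1 hw).1
  obtain ⟨v, w, hvw, hM2⟩ := card_eq_two.1 (show #(passing R U g) = 2 by omega)
  have hcard := card_pair hvw
  rw [← hM2] at hcard
  have hor : ∀ p, ∀ u ∈ good R U g p, u ∈ nbrs R v ∨ u ∈ nbrs R w := by
    intro p u hu
    obtain ⟨x, hx⟩ := card_pos.1 (hone p u hu)
    rw [mem_inter, mem_nbrs_comm, hM2, mem_insert, mem_singleton] at hx
    rcases hx with ⟨hx, rfl | rfl⟩ <;> simp [hx]
  have hfull : ∀ u, #(nbrs R u ∩ passing R U g) = 2 → u ∈ nbrs R v ∧ u ∈ nbrs R w := by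
    intro u hu
    have h1 := eq_of_subset_of_card_le (inter_subset_right : nbrs R u ∩ passing R U g ⊆ _)
      (by omega)
    rw [inter_eq_right, hM2, insert_subset_iff, singleton_subset_iff] at h1
    exact ⟨mem_nbrs_comm.1 h1.1, mem_nbrs_comm.1 h1.2⟩
  obtain ⟨p, hp0, hp2⟩ : ∃ p, (∀ u ∈ good R U g p, #(nbrs R u ∩ passing R U g) = 2) ∧
      ∀ u ∈ good R U g (p + 2), #(nbrs R u ∩ passing R U g) = 2 := by
    by_contra! hc
    have hc' : ∀ p, ∃ q, (q = p ∨ q = p + 2) ∧ ∃ u ∈ good R U g q,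
        #(nbrs R u ∩ passing R U g) ≠ 2 := by
      intro p
      by_cases hp : ∀ u ∈ good R U g p, #(nbrs R u ∩ passing R U g) = 2
      · exact ⟨_, .inr rfl, hc p hp⟩
      · push Not at hp
        exact ⟨_, .inl rfl, hp⟩
    obtain ⟨q, hq, u, hu, hu2⟩ := hc' 0
    obtain ⟨r, hr, u', hu', hu2'⟩ := hc' 1
    have i1 := hinter u
    have i2 := hinter u'
    have : r = q + 1 ∨ q = r + 1 := by
      clear hu hu'
      revert q r
      decide
    rcases this with rfl | rfl
    · have := h.card_passing_lt hu hu'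
      omega
    · have := h.card_passing_lt hu' hu
      omega
  refine h.false_of_dense hvw hM2 (p := p) ?_ ?_ ?_ ?_ (h.dense_of_forall_good (hor _))
    (h.dense_of_forall_good (hor _))
  · exact or_self_iff.1 (h.dense_of_forall_good fun u hu => .inl (hfull u (hp0 u hu)).1)
  · exact or_self_iff.1 (h.dense_of_forall_good fun u hu => .inl (hfull u (hp2 u hu)).1)
  · exact or_self_iff.1 (h.dense_of_forall_good fun u hu => .inl (hfull u (hp0 u hu)).2)
  · exact or_self_iff.1 (h.dense_of_forall_good fun u hu => .inl (hfull u (hp2 u hu)).2)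

end Tight

end Tight

theorem exists_hasCycle {ℓ : ℕ} (hℓ : 4 ≤ ℓ) (hmod : ℓ % 12 = 3) : ∃ n₀, ∀ (V : Type) [Fintype V],
    n₀ ≤ Fintype.card V → ∀ R : V → V → Prop, (∀ u v, R u v → ¬ R v u) →
    (∀ v, Fintype.card V + 1 ≤ 4 * #(outN R v)) → (∀ v, Fintype.card V + 1 ≤ 4 * #(inN R v)) →
    HasCycle R ℓ := by
  obtain ⟨C₀, hC₀, hframe⟩ := NearBipartite.exists_frame_of_quarterPair (C := 400) (by norm_num)
  obtain ⟨D, hD⟩ : ∃ D, D = 256 * C₀ := ⟨_, rfl⟩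
  obtain ⟨K, hK⟩ : ∃ K, K = 4 * D ^ 2 := ⟨_, rfl⟩
  have hK8 : 8 ≤ K := by nlinarith
  obtain ⟨n₁, hn₁⟩ := card_triangles_lt hℓ hmod (c := 1 / (192 * K ^ 2)) (by positivity)
  refine ⟨max n₁ (8 * K ^ 2 + 800 * C₀ * ℓ), fun V _ hn R hR hout hin => ?_⟩
  by_contra hno
  rw [max_le_iff] at hn
  have hℓC : ℓ ≤ C₀ * ℓ := Nat.le_mul_of_pos_left _ hC₀
  obtain ⟨f, hf⟩ : ∃ f, f = Fintype.card V / (8 * K ^ 2) := ⟨_, rfl⟩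
  have hK0 : 0 < 8 * K ^ 2 := by positivity
  have hf0 : 0 < f := hf ▸ Nat.div_pos (by omega) hK0
  have hfn : 8 * K ^ 2 * f ≤ Fintype.card V := hf ▸ Nat.mul_div_le _ _
  have hnf : Fintype.card V ≤ 16 * K ^ 2 * f := by
    have h1 := Nat.lt_mul_div_succ (Fintype.card V) hK0
    rw [← hf] at h1
    nlinarith
  have htri : 12 * #(triangles R) ≤ f * Fintype.card V ^ 2 := by
    have h1 := hn₁ V hn.1 R hR (fun v => ?_) (fun v => ?_) hno
    · have hKr : (0 : ℝ) < K := by positivity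
      have h2 : (Fintype.card V : ℝ) ≤ 16 * K ^ 2 * f := by exact_mod_cast hnf
      have h3 : 12 * (1 / (192 * (K : ℝ) ^ 2) * (Fintype.card V : ℝ) ^ 3) ≤
          f * (Fintype.card V : ℝ) ^ 2 := by
        rw [show 12 * (1 / (192 * (K : ℝ) ^ 2) * (Fintype.card V : ℝ) ^ 3) =
          Fintype.card V / (16 * K ^ 2) * (Fintype.card V : ℝ) ^ 2 by field_simp; ring]
        gcongr
        rw [div_le_iff₀ (by positivity)]
        linarith
      have h4 : (12 * #(triangles R) : ℝ) ≤ f * (Fintype.card V : ℝ) ^ 2 := by linarith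
      exact_mod_cast h4
    · have : (Fintype.card V : ℝ) + 1 ≤ 4 * #(outN R v) := by exact_mod_cast hout v
      linarith
    · have : (Fintype.card V : ℝ) + 1 ≤ 4 * #(inN R v) := by exact_mod_cast hin v
      linarith
  obtain ⟨e₁, hfe, he₁, hKe⟩ := exists_sq_ge (C := K) (p := 2 * f) (n := Fintype.card V) (by omega)
    (by omega) (by linarith)
  obtain ⟨e₂, hee, he₂, hDe⟩ := exists_sq_ge (C := D) (p := e₁) (n := Fintype.card V) (by omega)
    (by omega) (by rwa [← hK])
  have hCe : 256 * (C₀ * e₂) ≤ Fintype.card V := by rwa [hD, mul_assoc] at hDe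
  have heC : e₂ ≤ C₀ * e₂ := Nat.le_mul_of_pos_left _ hC₀
  have hCℓ : 800 * (C₀ * ℓ) ≤ Fintype.card V := by rw [← mul_assoc]; omega
  obtain ⟨X, Y, hXY⟩ := exists_nearBipartite hR
    (fun v => by rw [card_nbrs hR]; have := hout v; have := hin v; omega) hf0 htri
    (by linarith) he₂ (by omega) (by omega) (e := 4 * e₂) (by omega)
  obtain ⟨X, Y, L, a, b, hXY, hL, hLℓ, ha, hb⟩ := hXY.exists_odd_path hR hout hin (ℓ := ℓ)
    (by omega) (Nat.odd_iff.2 (by omega)) (by omega)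
  obtain ⟨A, B, hAB⟩ := hXY.exists_quarterPair hR hout hin (by omega) hno hL hLℓ ha hb
  obtain ⟨e, U, he, hU⟩ := hframe V R _ _ X Y A B hXY hR hout hin (by omega) (by omega) hAB
    (by linarith)
  exact Tight.elim (R := R) (U := U) (e := e) (g := e + 2 * ℓ) (ℓ := ℓ)
    ⟨hU, hR, hout, hin, hno, by omega, by omega, le_rfl, by omega⟩

end DiCycle

/-- For every integer `ℓ ≥ 4` with `ℓ ≡ 3 (mod 12)`, every sufficiently large oriented
graph with minimum semidegree at least `n/4 + 1/4` contains a directed `ℓ`-cycle. -/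
theorem cycle_of_semidegree_three_mod_twelve (ℓ : ℕ) (hℓ : 4 ≤ ℓ) (hmod : ℓ % 12 = 3) :
    ∃ n₀ : ℕ, ∀ n : ℕ, n₀ ≤ n → ∀ E : Fin n → Fin n → Prop, Oriented E →
      (∀ v, (n : ℝ) / 4 + 1 / 4 ≤ (semiDeg E v : ℝ)) →
      HasDiCycle E ℓ := by
  obtain ⟨n₀, h⟩ := DiCycle.exists_hasCycle hℓ hmod
  refine ⟨n₀, fun n hn E hE hdeg => ?_⟩
  have hmin : ∀ v, n + 1 ≤ 4 * semiDeg E v := fun v => by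
    have : (n : ℝ) + 1 ≤ 4 * semiDeg E v := by linarith [hdeg v]
    exact_mod_cast this
  have hout : ∀ v, outDeg E v = (DiCycle.outN E v).card := fun v => by
    rw [outDeg, ← Set.ncard_coe_finset]
    congr 1
    ext
    simp
  have hin : ∀ v, inDeg E v = (DiCycle.inN E v).card := fun v => by
    rw [inDeg, ← Set.ncard_coe_finset]
    congr 1
    ext
    simp
  refine h (Fin n) (by simpa using hn) E hE.2 (fun v => ?_) (fun v => ?_)
  · rw [Fintype.card_fin, ← hout]
    exact (hmin v).trans (Nat.mul_le_mul_left _ (min_le_left _ _))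
  · rw [Fintype.card_fin, ← hin]
    exact (hmin v).trans (Nat.mul_le_mul_left _ (min_le_right _ _))
end

section
/- For every integer ℓ ≥ 4, letting k be the smallest integer greater than 2 that does not divide ℓ, and setting b(n) := n/k + (k−1)/(2k) if ℓ ≢ 3 (mod 12) and b(n) := n/4 + 1/4 if ℓ ≡ 3 (mod 12), there are infinitely many n for which there exists an n-vertex oriented graph G that contains no directed cycle of length ℓ and has minimum semidegree δ±(G) > b(n) − 1. (That is, the semidegree bound forcing C_ℓ is best possible.) -/
/-- A directed cycle in a graph homomorphic to `C_k` has length divisible by `k`. -/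
theorem HomToCycle.dvd_of_hasDiCycle {n k t : ℕ} {E : Fin n → Fin n → Prop}
    (hE : HomToCycle E k) (ht : HasDiCycle E t) : k ∣ t := by
  obtain ⟨f, hf⟩ := hE
  obtain ⟨v, -, hv⟩ := ht
  have hwalk : ∀ j : ℕ, f (v j) = f (v 0) + j := by
    intro j
    induction j with
    | zero => simp
    | succ j ih =>
      push_cast
      rw [hf _ _ (hv j), ih, add_assoc]
  have h := hwalk t
  rw [ZMod.natCast_self, left_eq_add] at h
  exact (ZMod.natCast_eq_zero_iff t k).1 h

/-- For `k ≥ 3`, every graph homomorphic to `C_k` is oriented. -/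
theorem HomToCycle.oriented {n k : ℕ} {E : Fin n → Fin n → Prop}
    (hE : HomToCycle E k) (hk : 2 < k) : Oriented E := by
  obtain ⟨f, hf⟩ := hE
  constructor
  · intro v hv
    have h : ((1 : ℕ) : ZMod k) = 0 := by simpa using (hf v v hv).symm
    have := Nat.le_of_dvd one_pos ((ZMod.natCast_eq_zero_iff 1 k).1 h)
    omega
  · intro u v huv hvu
    have h : ((2 : ℕ) : ZMod k) = 0 := by
      have := hf v u hvu
      rw [hf u v huv, add_assoc, left_eq_add] at this
      rw [← this]
      norm_num
    have := Nat.le_of_dvd two_pos ((ZMod.natCast_eq_zero_iff 2 k).1 h)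
    omega

/-- The balanced blow-up of `C_k` with classes of size `m`. -/
theorem exists_homToCycle_semiDeg_eq (m k : ℕ) [NeZero k] :
    ∃ E : Fin (m * k) → Fin (m * k) → Prop, HomToCycle E k ∧ ∀ v, semiDeg E v = m := by
  let e : Fin (m * k) ≃ Fin m × ZMod k := Fintype.equivOfCardEq (by simp [ZMod.card])
  have hclass : ∀ c : ZMod k, {w | (e w).2 = c}.ncard = m := by
    intro c
    have h : {w | (e w).2 = c} = Set.range fun i : Fin m => e.symm (i, c) := by
      ext w
      constructor
      · rintro rfl
        exact ⟨(e w).1, by simp⟩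
      · rintro ⟨i, rfl⟩
        simp
    rw [h, Set.ncard_range_of_injective fun i j hij => by simpa using hij]
    simp
  refine ⟨fun u v => (e v).2 = (e u).2 + 1, ⟨fun v => (e v).2, fun _ _ h => h⟩, fun v => ?_⟩
  have hout : outDeg (fun u v => (e v).2 = (e u).2 + 1) v = m := hclass _
  have hin : inDeg (fun u v => (e v).2 = (e u).2 + 1) v = m := by
    simpa only [inDeg, eq_sub_iff_add_eq, eq_comm] using hclass ((e v).2 - 1)
  rw [semiDeg, hout, hin, min_self]

/-- The semidegree bound forcing `C_ℓ` is best possible: for infinitely many `n` there is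
an `n`-vertex oriented graph with no directed `ℓ`-cycle whose minimum semidegree exceeds
`b(n) - 1`, where `b(n) = n/4 + 1/4` if `ℓ ≡ 3 (mod 12)` and `b(n) = n/k + (k-1)/(2k)`
otherwise. -/
theorem semidegree_bound_best_possible (ℓ k : ℕ) (hℓ : 4 ≤ ℓ)
    (hk2 : 2 < k) (hkd : ¬ k ∣ ℓ) (hkmin : ∀ m : ℕ, 2 < m → ¬ m ∣ ℓ → k ≤ m) :
    ∀ N : ℕ, ∃ n : ℕ, N ≤ n ∧ ∃ E : Fin n → Fin n → Prop, Oriented E ∧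
      ¬ HasDiCycle E ℓ ∧
      (∀ v, (if ℓ % 12 = 3 then (n : ℝ) / 4 + 1 / 4
             else (n : ℝ) / k + ((k : ℝ) - 1) / (2 * k)) - 1 < (semiDeg E v : ℝ)) := by
  intro N
  have : NeZero k := ⟨by omega⟩
  obtain ⟨E, hE, hdeg⟩ := exists_homToCycle_semiDeg_eq N k
  refine ⟨N * k, Nat.le_mul_of_pos_right N (by omega), E, hE.oriented hk2,
    fun h => hkd (hE.dvd_of_hasDiCycle h), fun v => ?_⟩
  rw [hdeg]
  have hk0 : (0 : ℝ) < k := by exact_mod_cast (by omega : 0 < k)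
  push_cast
  split_ifs with hmod
  · have hk3 : k ≠ 3 := by
      rintro rfl
      exact hkd (by omega)
    have hk4 : k = 4 := le_antisymm (hkmin 4 (by norm_num) (by omega)) (by omega)
    subst hk4
    push_cast
    linarith
  · have h : ((k : ℝ) - 1) / (2 * k) < 1 := by
      rw [div_lt_one (by positivity)]
      linarith
    rw [mul_div_cancel_right₀ _ hk0.ne']
    linarith
end
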